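/- arXiv:1606.05019 — 7 statements merged into one kernel-verified Lean document; each statement's English description precedes it below -/
import Mathlib

section
/- Let s be an integer with 0 ≤ s ≤ m−1 and let J = J_s^{(q)} be its q-cyclotomic coset modulo m. Then r·J ≡ J (mod m) (i.e., multiplication by r permutes J), and exactly one of the following holds: (I) rs ≡ s (mod m), in which case rk ≡ k (mod m) for every k ∈ J; or (II) rs ≢ s (mod m), in which case rs mod m ∈ J, |J| is a multiple of 3, and rJ ≡ J (mod m). -/
/-- A finite set stable under a self-map of order dividing `3` without fixed points has
cardinality divisible by `3`. -/
theorem three_dvd_ncard_of_mapsTo {α : Type*} {S : Set α} (hS : S.Finite) {f : α → α}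
    (hf : Set.MapsTo f S S) (hf3 : ∀ k ∈ S, f (f (f k)) = k) (hfix : ∀ k ∈ S, f k ≠ k) :
    3 ∣ S.ncard := by
  classical
  have := hS.fintype
  let g : Function.End S := hf.restrict f S S
  have hg : g ^ 3 ^ 1 = 1 := by
    funext k
    exact Subtype.ext (hf3 k k.2)
  have hmod := Equiv.Perm.card_fixedPoints_modEq hg
  have hempty : IsEmpty (Function.fixedPoints g) :=
    ⟨fun k => hfix k.1 k.1.2 (congrArg Subtype.val k.2)⟩
  rw [Fintype.card_eq_zero (α := Function.fixedPoints g)] at hmod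
  rw [← Nat.card_coe_set_eq, Nat.card_eq_fintype_card]
  exact (Nat.modEq_zero_iff_dvd).1 hmod

/-- Let `J` be the `q`-cyclotomic coset of `s` modulo `m`. Then
multiplication by `r` permutes `J`, and exactly one of the following holds:
(I) `r*s ≡ s (mod m)`, in which case `r*k ≡ k (mod m)` for every `k ∈ J`; or
(II) `r*s ≢ s (mod m)`, in which case `r*s mod m ∈ J`, `3 ∣ |J|` and `rJ ≡ J`. -/
theorem stmt_0 (q m r s : ℕ) (hq : IsPrimePow q) (hm : 3 ≤ m)
    (hmq : Nat.gcd m q = 1) (hr1 : 1 < r) (hrm : r < m)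
    (hrgcd : Nat.gcd m r = 1) (hr3 : r ^ 3 ≡ 1 [MOD m])
    (ε : ℕ) (hε : 0 < ε) (hrq : r ≡ q ^ ε [MOD m])
    (hs : s ≤ m - 1)
    (J : Set ℕ) (hJ : J = {t | ∃ j : ℕ, t = s * q ^ j % m}) :
    (fun k => r * k % m) '' J = J ∧
    (r * s ≡ s [MOD m] → ∀ k ∈ J, r * k ≡ k [MOD m]) ∧
    (¬ r * s ≡ s [MOD m] →
      r * s % m ∈ J ∧ 3 ∣ J.ncard ∧ (fun k => r * k % m) '' J = J) := by
  have hlt : ∀ k ∈ J, k < m := by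
    subst hJ
    rintro _ ⟨j, rfl⟩
    exact Nat.mod_lt _ (by omega)
  have hmaps : Set.MapsTo (fun k => r * k % m) J J := by
    subst hJ
    rintro _ ⟨j, rfl⟩
    refine ⟨ε + j, ?_⟩
    calc r * (s * q ^ j % m) ≡ q ^ ε * (s * q ^ j) [MOD m] := hrq.mul (Nat.mod_modEq _ _)
      _ = s * q ^ (ε + j) := by ring
  have hcube : ∀ k ∈ J, r * (r * (r * k % m) % m) % m = k := by
    intro k hk
    have h : r * (r * (r * k % m) % m) ≡ k [MOD m] :=
      calc r * (r * (r * k % m) % m) ≡ r * (r * (r * k)) [MOD m] :=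
            ((Nat.mod_modEq _ _).trans ((Nat.mod_modEq _ _).mul_left r)).mul_left r
        _ = r ^ 3 * k := by ring
        _ ≡ 1 * k [MOD m] := hr3.mul_right k
        _ = k := one_mul k
    exact Eq.trans h (Nat.mod_eq_of_lt (hlt k hk))
  have himage : (fun k => r * k % m) '' J = J :=
    hmaps.image_subset.antisymm fun k hk => ⟨_, hmaps (hmaps hk), hcube k hk⟩
  have hfixed : ∀ k ∈ J, (r * k ≡ k [MOD m] ↔ r * s ≡ s [MOD m]) := by
    subst hJ
    rintro _ ⟨j, rfl⟩
    have hk : s * q ^ j % m ≡ s * q ^ j [MOD m] := Nat.mod_modEq _ _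
    constructor
    · intro h
      refine Nat.ModEq.cancel_right_of_coprime (c := q ^ j) (Nat.Coprime.pow_right j hmq) ?_
      rw [mul_assoc]
      exact (hk.mul_left r).symm.trans (h.trans hk)
    · intro h
      refine (hk.mul_left r).trans (Nat.ModEq.trans ?_ hk.symm)
      rw [← mul_assoc]
      exact h.mul_right _
  refine ⟨himage, fun h k hk => (hfixed k hk).2 h, fun h => ⟨?_, ?_, himage⟩⟩
  · refine hmaps (x := s) ?_
    rw [hJ]
    exact ⟨0, by rw [pow_zero, mul_one, Nat.mod_eq_of_lt (by omega)]⟩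
  · refine three_dvd_ncard_of_mapsTo ((Set.finite_lt_nat m).subset hlt) hmaps hcube ?_
    exact fun k hk hfix => h ((hfixed k hk).1 (hfix.trans (Nat.mod_eq_of_lt (hlt k hk)).symm))
end

section
/- For β, γ ∈ K, the line K·(γ, β, 1) ⊆ K³ is invariant under the skew cyclic shift T if and only if there exists α ∈ 𝒢 with γ = α^{−1} and β = θ²(α); moreover such α is unique. (This is the coordinate form of the statement that the monic right divisors of y³ − 1 of degree 2 in K[y;θ] are exactly the polynomials α^{−1} + θ²(α)y + y² with α ∈ 𝒢.) -/
/-- An automorphism of order three of a finite field of cardinality `q ^ d` over a field of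
cardinality `q` raises to the power `q ^ (d / 3)` or `q ^ (2 * (d / 3))`, so the product of the
conjugates of `a` under it is a power of `a`. -/
theorem mul_conj_eq_pow_of_orderOf_eq_three {q d : ℕ} (hq : 1 < q) (hd3 : 3 ∣ d)
    {F K : Type*} [Field F] [Fintype F] [Field K] [Fintype K] [Algebra F K]
    (hF : Fintype.card F = q) (hK : Fintype.card K = q ^ d)
    {θ : K ≃ₐ[F] K} (hθ : orderOf θ = 3) (a : K) :
    a * θ a * θ (θ a) = a ^ (1 + q ^ (d / 3) + q ^ (2 * (d / 3))) := by
  have hfin : Module.finrank F K = d := by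
    have h := Module.card_eq_pow_finrank (K := F) (V := K)
    rw [hK, hF] at h
    exact (Nat.pow_right_injective hq h).symm
  obtain ⟨k, hk⟩ := (FiniteField.bijective_frobeniusAlgEquivOfAlgebraic_pow F K).2 θ
  beta_reduce at hk
  obtain ⟨m, rfl⟩ := hd3
  have hkd : (k : ℕ) < 3 * m := hfin ▸ k.2
  have hord : orderOf (FiniteField.frobeniusAlgEquivOfAlgebraic F K) = 3 * m := by
    rw [FiniteField.orderOf_frobeniusAlgEquivOfAlgebraic, hfin]
  have happ (n : ℕ) (x : K) :
      (FiniteField.frobeniusAlgEquivOfAlgebraic F K ^ n) x = x ^ q ^ n := by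
    rw [AlgEquiv.coe_pow, FiniteField.coe_frobeniusAlgEquivOfAlgebraic_iterate, hF]
  have hdvd : 3 * m ∣ 3 * (k : ℕ) := by
    rw [← hord, orderOf_dvd_iff_pow_eq_one, mul_comm, pow_mul, hk, ← hθ, pow_orderOf_eq_one]
  obtain ⟨j, hj⟩ := Nat.dvd_of_mul_dvd_mul_left (by norm_num) hdvd
  have hj3 : j < 3 := by
    rw [hj, mul_comm 3] at hkd
    exact Nat.lt_of_mul_lt_mul_left hkd
  have hθa (x : K) : θ x = x ^ q ^ (m * j) := by rw [← hj, ← hk]; exact happ _ x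
  have hm : 3 * m / 3 = m := by omega
  have hcard (x : K) : x ^ q ^ (3 * m) = x := by rw [← hK, FiniteField.pow_card]
  rw [hm, hθa, hθa, ← pow_mul, ← pow_add]
  interval_cases j
  · have h1 : θ = 1 := by
      rw [← hk, hj]; simp
    simp [h1] at hθ
  · ring
  · have h4 : a ^ q ^ (m * 2 + m * 2) = a ^ q ^ m := by
      rw [show m * 2 + m * 2 = 3 * m + m by ring, pow_add, pow_mul, hcard]
    rw [h4]
    ring

theorem stmt_6 (q d : ℕ) (hq : IsPrimePow q) (hd : 0 < d) (hd3 : 3 ∣ d)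
    (F K : Type*) [Field F] [Fintype F] [Field K] [Fintype K] [Algebra F K]
    (hF : Fintype.card F = q) (hK : Fintype.card K = q ^ d)
    (θ : K ≃ₐ[F] K) (hθ : orderOf θ = 3)
    (β γ : K) :
    (∀ c ∈ Submodule.span K ({![γ, β, 1]} : Set (Fin 3 → K)),
        (![θ (c 2), θ (c 0), θ (c 1)] : Fin 3 → K) ∈
          Submodule.span K ({![γ, β, 1]} : Set (Fin 3 → K))) ↔
      ∃! α : K, (α ≠ 0 ∧ α ^ (1 + q ^ (d / 3) + q ^ (2 * (d / 3))) = 1) ∧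
        γ = α⁻¹ ∧ β = θ (θ α) := by
  have hθ3 (x : K) : θ (θ (θ x)) = x := by
    have h : θ ^ 3 = 1 := hθ ▸ pow_orderOf_eq_one θ
    simpa [pow_succ] using DFunLike.congr_fun h x
  have hnorm := mul_conj_eq_pow_of_orderOf_eq_three hq.one_lt hd3 hF hK hθ
  constructor
  · intro h
    obtain ⟨s, hs⟩ := Submodule.mem_span_singleton.1
      (h _ (Submodule.mem_span_singleton_self _))
    have h0 : s * γ = 1 := by simpa using congrFun hs 0
    have h1 : s * β = θ γ := by simpa using congrFun hs 1
    have h2 : s = θ β := by simpa using congrFun hs 2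
    have hs0 : s ≠ 0 := left_ne_zero_of_mul_eq_one h0
    have hβ : β = θ (θ s) := by rw [h2, hθ3]
    refine ⟨s, ⟨⟨hs0, ?_⟩, eq_inv_of_mul_eq_one_right h0, hβ⟩, fun t ht => ?_⟩
    · rw [← hnorm, ← hβ, mul_right_comm, h1, ← map_mul, mul_comm, h0, map_one]
    · rw [← inv_inv t, ← ht.2.1, eq_inv_of_mul_eq_one_left h0]
  · rintro ⟨a, ⟨⟨ha, hpow⟩, rfl, rfl⟩, -⟩ c hc
    rw [← hnorm] at hpow
    obtain ⟨s, rfl⟩ := Submodule.mem_span_singleton.1 hc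
    refine Submodule.mem_span_singleton.2 ⟨θ s * a, ?_⟩
    have hinv : a * θ (θ a) = (θ a)⁻¹ :=
      eq_inv_of_mul_eq_one_left (by rw [mul_right_comm]; exact hpow)
    ext i
    fin_cases i
    · simp [ha]
    · simp [mul_assoc, hinv]
    · simp [hθ3]
end

section
/- The skew θ-cyclic codes of length 3 over K (equivalently, the K-subspaces C ⊆ K³ with T(C) ⊆ C) are exactly the following pairwise distinct subspaces: {0}; K³; the 2-dimensional spaces C_{2,α} = span_K{(−α,1,0), (0,−θ(α),1)} for α ∈ 𝒢; and the lines C_{1,α} = K·(α^{−1}, θ²(α), 1) for α ∈ 𝒢. In particular, the number of skew θ-cyclic codes of length 3 over K is exactly 4 + 2q^{d/3} + 2q^{2d/3}. -/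
theorem mem_span_skewCyclicPlane {K : Type*} [Field K] {θ : K →+* K} {α : K} {c : Fin 3 → K} :
    c ∈ Submodule.span K ({![-α, 1, 0], ![0, -θ α, 1]} : Set (Fin 3 → K)) ↔
      c 0 + α * c 1 + α * θ α * c 2 = 0 := by
  rw [Submodule.mem_span_pair]
  constructor
  · rintro ⟨a, b, rfl⟩
    simp
    ring
  · intro h
    refine ⟨c 1 + θ α * c 2, c 2, ?_⟩
    ext i
    fin_cases i
    · simp
      linear_combination -h
    · simp
      ring
    · simp

theorem mem_span_skewCyclicLine {K : Type*} [Field K] {θ : K →+* K} {α : K} {c : Fin 3 → K} :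
    c ∈ Submodule.span K ({![α⁻¹, θ (θ α), 1]} : Set (Fin 3 → K)) ↔
      c 0 = c 2 * α⁻¹ ∧ c 1 = c 2 * θ (θ α) := by
  rw [Submodule.mem_span_singleton]
  constructor
  · rintro ⟨a, rfl⟩
    simp
  · rintro ⟨h0, h1⟩
    refine ⟨c 2, ?_⟩
    ext i
    fin_cases i <;> simp [h0, h1]

theorem eq_top_of_single_mem_of_skewCyclic {K : Type*} [Field K] {θ : K →+* K}
    {C : Submodule K (Fin 3 → K)}
    (hC : ∀ c ∈ C, (![θ (c 2), θ (c 0), θ (c 1)] : Fin 3 → K) ∈ C)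
    {x : K} (hx : x ≠ 0) (h : ![x, 0, 0] ∈ C) : C = ⊤ := by
  have e0 : ![1, 0, 0] ∈ C := by simpa [hx] using C.smul_mem x⁻¹ h
  have e1 : ![0, 1, 0] ∈ C := by simpa using hC _ e0
  have e2 : ![0, 0, 1] ∈ C := by simpa using hC _ e1
  refine (Submodule.eq_top_iff').2 fun c ↦ ?_
  convert C.add_mem (C.add_mem (C.smul_mem (c 0) e0) (C.smul_mem (c 1) e1))
    (C.smul_mem (c 2) e2) using 1
  ext i
  fin_cases i <;> simp

theorem skewCyclic_plane_of_mem {K : Type*} [Field K] {θ : K →+* K}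
    {C : Submodule K (Fin 3 → K)}
    (hC : ∀ c ∈ C, (![θ (c 2), θ (c 0), θ (c 1)] : Fin 3 → K) ∈ C) (hT : C ≠ ⊤)
    {α : K} (h : ![-α, 1, 0] ∈ C) :
    α * θ α * θ (θ α) = 1 ∧
      C = Submodule.span K ({![-α, 1, 0], ![0, -θ α, 1]} : Set (Fin 3 → K)) := by
  have hz : ∀ x : K, ![x, 0, 0] ∈ C → x = 0 := fun x hx ↦ by
    by_contra h0
    exact hT (eq_top_of_single_mem_of_skewCyclic hC h0 hx)
  have h' : ![0, -θ α, 1] ∈ C := by simpa using hC _ h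
  have h'' : ![1, 0, -θ (θ α)] ∈ C := by simpa using hC _ h'
  refine ⟨?_, le_antisymm (fun c hc ↦ mem_span_skewCyclicPlane.2 <| hz _ ?_) ?_⟩
  · have key : ![1 - α * θ α * θ (θ α), 0, 0] ∈ C := by
      convert C.add_mem (C.add_mem h'' (C.smul_mem (θ (θ α)) h'))
        (C.smul_mem (θ α * θ (θ α)) h) using 1
      ext i
      fin_cases i <;> simp <;> ring
    exact (sub_eq_zero.1 (hz _ key)).symm
  · convert C.sub_mem hc (C.add_mem (C.smul_mem (c 1 + θ α * c 2) h) (C.smul_mem (c 2) h'))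
      using 1
    ext i
    fin_cases i <;> simp <;> ring
  · rw [Submodule.span_le]
    rintro c (rfl | rfl)
    exacts [h, h']

theorem skewCyclic_line_of_mem {K : Type*} [Field K] {θ : K →+* K}
    (hθ : ∀ x, θ (θ (θ x)) = x) {C : Submodule K (Fin 3 → K)}
    (hC : ∀ c ∈ C, (![θ (c 2), θ (c 0), θ (c 1)] : Fin 3 → K) ∈ C)
    (hz : ∀ c ∈ C, c 2 = 0 → c = 0) {a b : K} (h : ![a, b, 1] ∈ C) :
    ∃ α : K, α * θ α * θ (θ α) = 1 ∧
      C = Submodule.span K ({![α⁻¹, θ (θ α), 1]} : Set (Fin 3 → K)) := by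
  have hs : ∀ c ∈ C, c = c 2 • ![a, b, 1] := fun c hc ↦
    sub_eq_zero.1 (hz _ (C.sub_mem hc (C.smul_mem (c 2) h)) (by simp))
  have hT := hs _ (hC _ h)
  have h0 := congrFun hT 0
  have h1 := congrFun hT 1
  simp at h0 h1
  have ha : a = (θ b)⁻¹ := eq_inv_of_mul_eq_one_right h0.symm
  have hb : θ b ≠ 0 := fun hb ↦ by simp [hb] at h0
  have hab : ![a, b, 1] = ![(θ b)⁻¹, θ (θ (θ b)), 1] := by rw [ha, hθ]
  refine ⟨θ b, ?_, le_antisymm (fun c hc ↦ ?_) ?_⟩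
  · have h2 : θ a * θ (θ b) = 1 := by rw [← map_mul, mul_comm, ← h0, map_one]
    rw [hθ, ← h2, h1]
    ring
  · rw [hs c hc, hab]
    exact Submodule.smul_mem _ _ (Submodule.mem_span_singleton_self _)
  · rw [Submodule.span_singleton_le_iff_mem, ← hab]
    exact h

/-- Classification of the subspaces of `K³` invariant under the skew cyclic shift attached to an
endomorphism `θ` of `K` with `θ³ = 1`. -/
theorem skewCyclic_iff {K : Type*} [Field K] {θ : K →+* K}
    (hθ : ∀ x, θ (θ (θ x)) = x) (C : Submodule K (Fin 3 → K)) :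
    (∀ c ∈ C, (![θ (c 2), θ (c 0), θ (c 1)] : Fin 3 → K) ∈ C) ↔
      (C = ⊥ ∨ C = ⊤ ∨
        (∃ α : K, α * θ α * θ (θ α) = 1 ∧
          C = Submodule.span K ({![-α, 1, 0], ![0, -θ α, 1]} : Set (Fin 3 → K))) ∨
        (∃ α : K, α * θ α * θ (θ α) = 1 ∧
          C = Submodule.span K ({![α⁻¹, θ (θ α), 1]} : Set (Fin 3 → K)))) := by
  constructor
  · intro hC
    by_cases hT : C = ⊤
    · exact Or.inr (Or.inl hT)
    by_cases hz : ∀ c ∈ C, c 2 = 0 → c = 0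
    · by_cases hB : C = ⊥
      · exact Or.inl hB
      obtain ⟨c, hc, hc0⟩ := Submodule.exists_mem_ne_zero_of_ne_bot hB
      have h2 : c 2 ≠ 0 := fun h2 ↦ hc0 (hz c hc h2)
      have h : ![(c 2)⁻¹ * c 0, (c 2)⁻¹ * c 1, 1] ∈ C := by
        convert C.smul_mem (c 2)⁻¹ hc using 1
        ext i
        fin_cases i <;> simp [h2]
      exact Or.inr (Or.inr (Or.inr (skewCyclic_line_of_mem hθ hC hz h)))
    · push Not at hz
      obtain ⟨c, hc, h2, hc0⟩ := hz
      by_cases h1 : c 1 = 0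
      · refine absurd (eq_top_of_single_mem_of_skewCyclic hC (x := c 0) ?_ ?_) hT
        · intro h0
          refine hc0 (funext fun i ↦ ?_)
          fin_cases i <;> assumption
        · convert hc using 1
          ext i
          fin_cases i <;> simp [h1, h2]
      · have h : ![-(-((c 1)⁻¹ * c 0)), 1, 0] ∈ C := by
          convert C.smul_mem (c 1)⁻¹ hc using 1
          ext i
          fin_cases i <;> simp [h1, h2]
        exact Or.inr (Or.inr (Or.inl ⟨_, skewCyclic_plane_of_mem hC hT h⟩))
  · rintro (rfl | rfl | ⟨α, hα, rfl⟩ | ⟨α, hα, rfl⟩) c hc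
    · rw [Submodule.mem_bot] at hc ⊢
      subst hc
      ext i
      fin_cases i <;> simp
    · trivial
    · rw [mem_span_skewCyclicPlane] at hc ⊢
      have h := congrArg θ hc
      simp only [map_add, map_mul, map_zero] at h
      simp only [Matrix.cons_val]
      linear_combination α * h - θ (c 2) * hα
    · rw [mem_span_skewCyclicLine] at hc ⊢
      have h0 : α ≠ 0 := by rintro rfl; simp at hα
      have h1 : θ α ≠ 0 := (map_ne_zero θ).2 h0
      simp only [Matrix.cons_val]
      rw [hc.1, hc.2]
      simp only [map_mul, map_inv₀, hθ]
      refine ⟨by field_simp, ?_⟩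
      field_simp
      linear_combination -θ (c 2) * hα

theorem card_skewCyclic {K : Type*} [Field K] [Finite K] {θ : K →+* K}
    (hθ : ∀ x, θ (θ (θ x)) = x) :
    Nat.card {C : Submodule K (Fin 3 → K) //
        ∀ c ∈ C, (![θ (c 2), θ (c 0), θ (c 1)] : Fin 3 → K) ∈ C} =
      2 + 2 * Nat.card {α : K // α * θ α * θ (θ α) = 1} := by
  let G := {α : K // α * θ α * θ (θ α) = 1}
  let plane (α : K) : Submodule K (Fin 3 → K) := Submodule.span K {![-α, 1, 0], ![0, -θ α, 1]}
  let line (α : K) : Submodule K (Fin 3 → K) := Submodule.span K {![α⁻¹, θ (θ α), 1]}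
  let f : Bool ⊕ (G ⊕ G) → Submodule K (Fin 3 → K) :=
    Sum.elim (fun b ↦ if b then ⊤ else ⊥) (Sum.elim (fun α ↦ plane α) (fun α ↦ line α))
  have hplane {α c} : c ∈ plane α ↔ c 0 + α * c 1 + α * θ α * c 2 = 0 := mem_span_skewCyclicPlane
  have hline {α c} : c ∈ line α ↔ c 0 = c 2 * α⁻¹ ∧ c 1 = c 2 * θ (θ α) :=
    mem_span_skewCyclicLine
  have plane_mem (α) : ![-α, 1, 0] ∈ plane α := hplane.2 (by simp)
  have line_mem (α) : ![α⁻¹, θ (θ α), 1] ∈ line α := hline.2 (by simp)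
  have bot_ne_top : (⊥ : Submodule K (Fin 3 → K)) ≠ ⊤ := bot_ne_top
  have plane_ne_bot (α) : plane α ≠ ⊥ := fun h ↦ by
    have := congrFun ((Submodule.mem_bot K).1 (h ▸ plane_mem α : ![-α, 1, 0] ∈ _)) 1
    simp at this
  have line_ne_bot (α) : line α ≠ ⊥ := fun h ↦ by
    have := congrFun ((Submodule.mem_bot K).1 (h ▸ line_mem α : ![α⁻¹, θ (θ α), 1] ∈ _)) 2
    simp at this
  have plane_ne_top (α) : plane α ≠ ⊤ := fun h ↦ by
    have := hplane.1 (h ▸ Submodule.mem_top : ![1, 0, 0] ∈ plane α)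
    simp at this
  have line_ne_top (α) : line α ≠ ⊤ := fun h ↦ by
    have := hline.1 (h ▸ Submodule.mem_top : ![1, 0, 0] ∈ line α)
    simp at this
  have plane_ne_line (α β) : plane α ≠ line β := fun h ↦ by
    have := hline.1 (h ▸ plane_mem α)
    simp at this
  have plane_inj {α β} (h : plane α = plane β) : α = β := by
    have := hplane.1 (h ▸ plane_mem α)
    simp at this
    linear_combination -this
  have line_inj {α β} (h : line α = line β) : α = β := by
    have := hline.1 (h ▸ line_mem α)
    simpa using this.1
  have hf : Function.Injective f := by
    refine Function.Injective.sumElim ?_ (Function.Injective.sumElim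
      (fun α β h ↦ Subtype.ext (plane_inj h)) (fun α β h ↦ Subtype.ext (line_inj h))
      fun α β ↦ plane_ne_line α β) ?_
    · rintro (_ | _) (_ | _) h
      · rfl
      · exact absurd h bot_ne_top
      · exact absurd h.symm bot_ne_top
      · rfl
    · rintro (_ | _) (α | α)
      · exact (plane_ne_bot α).symm
      · exact (line_ne_bot α).symm
      · exact (plane_ne_top α).symm
      · exact (line_ne_top α).symm
  have hr (C : Submodule K (Fin 3 → K)) : C ∈ Set.range f ↔
      ∀ c ∈ C, (![θ (c 2), θ (c 0), θ (c 1)] : Fin 3 → K) ∈ C := by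
    rw [skewCyclic_iff hθ]
    simp only [f, G, plane, line, Set.mem_range, Sum.exists, Sum.elim_inl, Sum.elim_inr,
      Bool.exists_bool, Subtype.exists, exists_prop, or_assoc, if_true, Bool.false_eq_true,
      if_false, eq_comm (b := C)]
  rw [← Nat.card_congr ((Equiv.ofInjective f hf).trans (Equiv.subtypeEquivRight hr)),
    Nat.card_sum, Nat.card_sum, Nat.card_eq_fintype_card (α := Bool), Fintype.card_bool]
  ring

theorem FiniteField.mul_orderThree_orbit_eq_pow {F K : Type*} [Field F] [Fintype F] [Field K]
    [Fintype K] [Algebra F K] {m : ℕ} (hK : Fintype.card K = Fintype.card F ^ (3 * m))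
    (θ : K ≃ₐ[F] K) (hθ : orderOf θ = 3) (α : K) :
    α * θ α * θ (θ α) = α ^ (1 + Fintype.card F ^ m + Fintype.card F ^ (2 * m)) := by
  have hrank : Module.finrank F K = 3 * m :=
    Nat.pow_right_injective (Fintype.one_lt_card (α := F))
      ((Module.card_eq_pow_finrank (K := F) (V := K)).symm.trans hK)
  obtain ⟨⟨n, hn⟩, h⟩ := (FiniteField.bijective_frobeniusAlgEquivOfAlgebraic_pow F K).2 θ
  dsimp only at h
  have happly (x : K) : θ x = x ^ Fintype.card F ^ n := by
    rw [← h, AlgEquiv.coe_pow, FiniteField.coe_frobeniusAlgEquivOfAlgebraic_iterate]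
  have hdvd : 3 * m ∣ n * 3 := by
    rw [← hrank, ← FiniteField.orderOf_frobeniusAlgEquivOfAlgebraic F K,
      orderOf_dvd_iff_pow_eq_one, pow_mul, h, ← hθ, pow_orderOf_eq_one]
  have hn0 : n ≠ 0 := by
    rintro rfl
    rw [pow_zero] at h
    rw [← h, orderOf_one] at hθ
    omega
  have hn' : n = m ∨ n = 2 * m := by
    rw [mul_comm n, Nat.mul_dvd_mul_iff_left (by norm_num)] at hdvd
    obtain ⟨k, rfl⟩ := hdvd
    rw [hrank, mul_comm] at hn
    have hk : k < 3 := Nat.lt_of_mul_lt_mul_right hn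
    interval_cases k
    · simp at hn0
    · simp
    · exact Or.inr (mul_comm _ _)
  rw [happly (θ α), happly α, ← pow_mul, ← pow_add]
  obtain rfl | rfl := hn'
  · rw [pow_add, pow_add, pow_add, pow_one, two_mul, pow_add]
  · have hα : α ^ (Fintype.card F ^ (2 * m) * Fintype.card F ^ (2 * m)) =
        α ^ Fintype.card F ^ m := by
      rw [show Fintype.card F ^ (2 * m) * Fintype.card F ^ (2 * m) =
        Fintype.card F ^ (3 * m) * Fintype.card F ^ m by ring, ← hK, pow_mul,
        FiniteField.pow_card]
    rw [pow_add, pow_add, pow_add, pow_one, ← hα]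
    ring

theorem FiniteField.card_pow_eq_one_of_dvd {K : Type*} [Field K] [Fintype K] {n : ℕ} (hn : n ≠ 0)
    (h : n ∣ Fintype.card K - 1) : Nat.card {α : K // α ^ n = 1} = n := by
  have hc := IsCyclic.card_powMonoidHom_ker (G := Kˣ) n
  rw [Nat.card_units, Nat.card_eq_fintype_card (α := K), Nat.gcd_eq_right h] at hc
  have hker (u : Kˣ) : u ∈ (powMonoidHom n : Kˣ →* Kˣ).ker ↔ (u : K) ^ n = 1 := by
    rw [MonoidHom.mem_ker, powMonoidHom_apply, Units.ext_iff, Units.val_pow_eq_pow_val,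
      Units.val_one]
  refine (Nat.card_congr (Equiv.ofBijective
    (fun u : (powMonoidHom n : Kˣ →* Kˣ).ker ↦
      (⟨u.1, (hker u.1).1 u.2⟩ : {α : K // α ^ n = 1})) ⟨fun u v h ↦ ?_, fun α ↦ ?_⟩)).symm.trans ?_
  · exact Subtype.ext (Units.ext (Subtype.ext_iff.1 h))
  · exact ⟨⟨Units.ofPowEqOne α.1 n α.2 hn, (hker _).2 α.2⟩, rfl⟩
  · exact hc

/-- The skew `θ`-cyclic codes of length 3 over `K` (the
`K`-subspaces `C ⊆ K³` invariant under the skew cyclic shift `T`) are exactly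
`{0}`, `K³`, the planes `C_{2,α} = span{(−α,1,0),(0,−θ(α),1)}` for `α ∈ 𝒢`, and
the lines `C_{1,α} = K·(α⁻¹, θ²(α), 1)` for `α ∈ 𝒢`; their total number is
`4 + 2q^{d/3} + 2q^{2d/3}`. -/
theorem stmt_9 (q d : ℕ) (hq : IsPrimePow q) (hd : 0 < d) (hd3 : 3 ∣ d)
    (F K : Type*) [Field F] [Fintype F] [Field K] [Fintype K] [Algebra F K]
    (hF : Fintype.card F = q) (hK : Fintype.card K = q ^ d)
    (θ : K ≃ₐ[F] K) (hθ : orderOf θ = 3) :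
    (∀ C : Submodule K (Fin 3 → K),
      (∀ c ∈ C, (![θ (c 2), θ (c 0), θ (c 1)] : Fin 3 → K) ∈ C) ↔
        (C = ⊥ ∨ C = ⊤ ∨
         (∃ α : K, (α ≠ 0 ∧ α ^ (1 + q ^ (d / 3) + q ^ (2 * (d / 3))) = 1) ∧
            C = Submodule.span K ({![-α, 1, 0], ![0, -θ α, 1]} : Set (Fin 3 → K))) ∨
         (∃ α : K, (α ≠ 0 ∧ α ^ (1 + q ^ (d / 3) + q ^ (2 * (d / 3))) = 1) ∧
            C = Submodule.span K ({![α⁻¹, θ (θ α), 1]} : Set (Fin 3 → K))))) ∧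
    Nat.card {C : Submodule K (Fin 3 → K) //
        ∀ c ∈ C, (![θ (c 2), θ (c 0), θ (c 1)] : Fin 3 → K) ∈ C} =
      4 + 2 * q ^ (d / 3) + 2 * q ^ (2 * (d / 3)) := by
  obtain ⟨m, rfl⟩ := hd3
  subst hF
  have hdiv : 3 * m / 3 = m := by omega
  rw [hdiv]
  have hnorm := FiniteField.mul_orderThree_orbit_eq_pow hK θ hθ
  have hθ3 (x : K) : (θ : K →+* K) ((θ : K →+* K) ((θ : K →+* K) x)) = x := by
    have h := pow_orderOf_eq_one θ
    rw [hθ] at h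
    exact DFunLike.congr_fun h x
  set N := 1 + Fintype.card F ^ m + Fintype.card F ^ (2 * m) with hN
  have hN0 : N ≠ 0 := by omega
  have hG (α : K) : (α ≠ 0 ∧ α ^ N = 1) ↔ α * θ α * θ (θ α) = 1 := by
    rw [hnorm]
    refine ⟨And.right, fun h ↦ ⟨?_, h⟩⟩
    rintro rfl
    simp [hN0] at h
  refine ⟨fun C ↦ ?_, ?_⟩
  · simp only [hG]
    exact skewCyclic_iff hθ3 C
  · have hdvd : N ∣ Fintype.card K - 1 := by
      refine ⟨Fintype.card F ^ m - 1, ?_⟩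
      have hq1 : 1 ≤ Fintype.card F ^ m := Nat.one_le_pow _ _ Fintype.card_pos
      rw [hK, hN, Nat.mul_sub, mul_one]
      refine Nat.sub_eq_of_eq_add ?_
      zify [Nat.le_mul_of_pos_right N hq1]
      rw [Nat.cast_sub (by nlinarith)]
      push_cast
      ring
    refine (card_skewCyclic hθ3).trans ?_
    have hcard : Nat.card {α : K // α * θ α * θ (θ α) = 1} = N := by
      simp only [hnorm]
      exact FiniteField.card_pow_eq_one_of_dvd hN0 hdvd
    refine (congrArg (2 + 2 * ·) hcard).trans ?_
    simp only [hN]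
    ring
end

section
/- For every α ∈ 𝒢, the subspace C_{2,α} = span_K{(−α,1,0), (0,−θ(α),1)} ⊆ K³ is a skew θ-cyclic code of length 3 over K with dim_K C_{2,α} = 2 (so |C_{2,α}| = q^{2d}), and its minimum Hamming weight equals 2; hence C_{2,α} is an MDS linear [3,2,2] code over K. -/
/-- For an automorphism `θ` of order `3` of an extension of finite fields of degree `d`, the
product `a * θ a * θ (θ a)` is a power of `a`, with exponent determined by `d`. -/
theorem mul_apply_mul_apply_apply_eq_pow_of_orderOf_eq_three
    {F K : Type*} [Field F] [Fintype F] [Field K] [Fintype K] [Algebra F K]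
    (d : ℕ) (hK : Fintype.card K = Fintype.card F ^ d)
    (θ : K ≃ₐ[F] K) (hθ : orderOf θ = 3) (a : K) :
    a * θ a * θ (θ a) =
      a ^ (1 + Fintype.card F ^ (d / 3) + Fintype.card F ^ (2 * (d / 3))) := by
  obtain ⟨i, hi⟩ := (FiniteField.bijective_frobeniusAlgEquivOfAlgebraic_pow F K).2 θ
  have hrank : Module.finrank F K = d := by
    have h := Module.card_eq_pow_finrank (K := F) (V := K)
    rw [hK] at h
    exact (Nat.pow_right_injective Fintype.one_lt_card h).symm
  have hord := FiniteField.orderOf_frobeniusAlgEquivOfAlgebraic F K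
  rw [hrank] at hord
  have hlt : (i : ℕ) < d := hrank ▸ i.2
  simp only at hi
  have hdvd : d ∣ 3 * (i : ℕ) := by
    rw [← hord, orderOf_dvd_iff_pow_eq_one, mul_comm, pow_mul, hi, ← hθ, pow_orderOf_eq_one]
  have hne : (i : ℕ) ≠ 0 := by
    intro h
    rw [h, pow_zero] at hi
    rw [← hi, orderOf_one] at hθ
    omega
  have happ : ∀ x : K, θ x = x ^ Fintype.card F ^ (i : ℕ) := by
    intro x
    rw [← hi, AlgEquiv.coe_pow, FiniteField.coe_frobeniusAlgEquivOfAlgebraic_iterate]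
  have hcard : a ^ Fintype.card F ^ d = a := by rw [← hK, FiniteField.pow_card]
  obtain ⟨k, hk⟩ := hdvd
  have hk3 : k < 3 := by
    by_contra h
    nlinarith
  have hk0 : k ≠ 0 := by
    rintro rfl
    omega
  have hθθ : θ (θ a) = a ^ Fintype.card F ^ (2 * (i : ℕ)) := by
    rw [happ, happ, ← pow_mul, ← pow_add, two_mul]
  rw [hθθ, happ, pow_add, pow_add, pow_one]
  obtain rfl | rfl : k = 1 ∨ k = 2 := by omega
  · have : (i : ℕ) = d / 3 := by omega
    rw [this]
  · have h1 : (i : ℕ) = 2 * (d / 3) := by omega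
    have h2 : 2 * (i : ℕ) = d + d / 3 := by omega
    rw [h2, h1, pow_add _ d, pow_mul a, hcard]
    ring

/-- The code spanned by `(-a, 1, 0)` and `(0, -b, 1)` is the kernel of the parity check
`(1, a, ab)`. -/
theorem mem_span_pair_iff_parity_check {K : Type*} [Field K] (a b : K) (c : Fin 3 → K) :
    c ∈ Submodule.span K ({![-a, 1, 0], ![0, -b, 1]} : Set (Fin 3 → K)) ↔
      c 0 + a * c 1 + a * b * c 2 = 0 := by
  rw [Submodule.mem_span_pair]
  constructor
  · rintro ⟨s, t, rfl⟩
    simp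
    ring
  · intro h
    refine ⟨c 1 + b * c 2, c 2, ?_⟩
    ext j
    fin_cases j
    · simp
      linear_combination -h
    · simp
      ring
    · simp

theorem finrank_span_parity_check_pair {K : Type*} [Field K] (a b : K) :
    Module.finrank K
      (Submodule.span K ({![-a, 1, 0], ![0, -b, 1]} : Set (Fin 3 → K))) = 2 := by
  have hli : LinearIndependent K ![(![-a, 1, 0] : Fin 3 → K), ![0, -b, 1]] := by
    rw [LinearIndependent.pair_iff]
    intro s t h
    have h1 := congrFun h 1
    have h2 := congrFun h 2
    simp at h1 h2
    subst h2
    simpa using h1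
  have := finrank_span_eq_card hli
  rwa [Matrix.range_cons_cons_empty, Fintype.card_fin] at this

/-- For every `α ∈ 𝒢`, the subspace
`C_{2,α} = span{(−α,1,0), (0,−θ(α),1)} ⊆ K³` is a skew `θ`-cyclic code of
length 3 over `K` of dimension `2` (so of cardinality `q^{2d}`) and minimum
Hamming weight `2`; hence it is an MDS `[3,2,2]` code over `K`. -/
theorem stmt_10 (q d : ℕ) (hq : IsPrimePow q) (hd : 0 < d) (hd3 : 3 ∣ d)
    (F K : Type*) [Field F] [Fintype F] [Field K] [Fintype K] [DecidableEq K]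
    [Algebra F K] (hF : Fintype.card F = q) (hK : Fintype.card K = q ^ d)
    (θ : K ≃ₐ[F] K) (hθ : orderOf θ = 3)
    (α : K) (hα : α ≠ 0 ∧ α ^ (1 + q ^ (d / 3) + q ^ (2 * (d / 3))) = 1) :
    (∀ c ∈ Submodule.span K ({![-α, 1, 0], ![0, -θ α, 1]} : Set (Fin 3 → K)),
        (![θ (c 2), θ (c 0), θ (c 1)] : Fin 3 → K) ∈
          Submodule.span K ({![-α, 1, 0], ![0, -θ α, 1]} : Set (Fin 3 → K))) ∧
    Module.finrank K
        (Submodule.span K ({![-α, 1, 0], ![0, -θ α, 1]} : Set (Fin 3 → K))) = 2 ∧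
    Nat.card
        (Submodule.span K ({![-α, 1, 0], ![0, -θ α, 1]} : Set (Fin 3 → K))) =
      q ^ (2 * d) ∧
    (∀ c ∈ Submodule.span K ({![-α, 1, 0], ![0, -θ α, 1]} : Set (Fin 3 → K)),
        c ≠ 0 → 2 ≤ hammingNorm c) ∧
    (∃ c ∈ Submodule.span K ({![-α, 1, 0], ![0, -θ α, 1]} : Set (Fin 3 → K)),
        c ≠ 0 ∧ hammingNorm c = 2) := by
  obtain ⟨hα0, hα1⟩ := hα
  subst hF
  have hθα : θ α ≠ 0 := by simpa using hα0
  have hnorm : α * θ α * θ (θ α) = 1 := by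
    rw [mul_apply_mul_apply_apply_eq_pow_of_orderOf_eq_three d hK θ hθ, hα1]
  have hrank := finrank_span_parity_check_pair α (θ α)
  refine ⟨fun c hc ↦ ?_, hrank, ?_, fun c hc hc0 ↦ ?_, ![-α, 1, 0],
    Submodule.subset_span (by simp), fun h ↦ ?_, ?_⟩
  · rw [mem_span_pair_iff_parity_check] at hc ⊢
    have h := congrArg θ hc
    simp only [map_add, map_mul, map_zero] at h
    simp only [Matrix.cons_val]
    linear_combination α * h - θ (c 2) * hnorm
  · rw [Module.natCard_eq_pow_finrank (K := K), hrank, Nat.card_eq_fintype_card, hK, ← pow_mul,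
      mul_comm]
  · rw [mem_span_pair_iff_parity_check] at hc
    by_contra! hlt
    have hle : hammingNorm c ≤ 1 := by omega
    rw [hammingNorm, Finset.card_le_one] at hle
    simp only [Finset.mem_filter, Finset.mem_univ, true_and] at hle
    obtain ⟨j, hj⟩ := Function.ne_iff.mp hc0
    have hz : ∀ k, k ≠ j → c k = 0 := fun k hk ↦ by
      by_contra h
      exact hk (hle k h j hj)
    fin_cases j
    · simp_all
    · simp_all
    · simp_all
  · simpa using congrFun h 1
  · have : (Finset.univ.filter fun j ↦ (![-α, 1, 0] : Fin 3 → K) j ≠ 0) = {0, 1} := by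
      ext j
      fin_cases j <;> simp [hα0]
    rw [hammingNorm, this]
    rfl
end

section
/- Let α, β ∈ 𝒢. Then the line C_{1,β} = K·(β^{−1}, θ²(β), 1) is contained in the subspace C_{2,α} = span_K{(−α,1,0), (0,−θ(α),1)} of K³ if and only if α·θ(α)·β + α·β·θ²(β) + 1 = 0. (Equivalently: y−α is a right divisor of β^{−1} + θ²(β)y + y² in K[y;θ] iff this equation holds.) -/
/-- Let `α, β ∈ 𝒢`. Then the line `C_{1,β} = K·(β⁻¹, θ²(β), 1)`
is contained in `C_{2,α} = span{(−α,1,0), (0,−θ(α),1)}` if and only if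
`α·θ(α)·β + α·β·θ²(β) + 1 = 0`. -/
theorem stmt_13 (q d : ℕ) (hq : IsPrimePow q) (hd : 0 < d) (hd3 : 3 ∣ d)
    (F K : Type*) [Field F] [Fintype F] [Field K] [Fintype K] [Algebra F K]
    (hF : Fintype.card F = q) (hK : Fintype.card K = q ^ d)
    (θ : K ≃ₐ[F] K) (hθ : orderOf θ = 3)
    (α β : K)
    (hα : α ≠ 0 ∧ α ^ (1 + q ^ (d / 3) + q ^ (2 * (d / 3))) = 1)
    (hβ : β ≠ 0 ∧ β ^ (1 + q ^ (d / 3) + q ^ (2 * (d / 3))) = 1) :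
    Submodule.span K ({![β⁻¹, θ (θ β), 1]} : Set (Fin 3 → K)) ≤
        Submodule.span K ({![-α, 1, 0], ![0, -θ α, 1]} : Set (Fin 3 → K)) ↔
      α * θ α * β + α * β * θ (θ β) + 1 = 0 := by
  rw [Submodule.span_singleton_le_iff_mem, Submodule.mem_span_pair]
  have hβ0 := hβ.1
  constructor
  · rintro ⟨a, b, h⟩
    have h0 : -(a * α) = β⁻¹ := by simpa using congrFun h 0
    have h1 : a + -(b * θ α) = θ (θ β) := by simpa using congrFun h 1
    have h2 : b = 1 := by simpa using congrFun h 2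
    subst h2
    have hinv : β⁻¹ * β = 1 := inv_mul_cancel₀ hβ0
    rw [← h0] at hinv
    linear_combination -α * β * h1 - hinv
  · intro h
    refine ⟨θ (θ β) + θ α, 1, ?_⟩
    ext i
    fin_cases i
    · simp
      field_simp
      linear_combination -h
    · simp
    · simp
end

section
/- For each fixed β ∈ 𝒢, the number of α ∈ 𝒢 satisfying α·θ(α)·β + α·β·θ²(β) + 1 = 0 (equivalently, the number of codes C_{2,α} containing C_{1,β}) is exactly q^{d/3} + 1. Symmetrically, for each fixed α ∈ 𝒢, the number of β ∈ 𝒢 satisfying the same equation (equivalently, the number of codes C_{1,β} contained in C_{2,α}) is exactly q^{d/3} + 1. -/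
open Polynomial in
/-- The trinomial `X ^ (s + 1) + X + 1` has `s + 1` distinct roots in the field with `s ^ 3`
elements: it divides `X ^ (s ^ 2 + s + 1) - 1`. -/
theorem ncard_roots_trinomial {K : Type*} [Field K] [Fintype K] {s : ℕ}
    (hs : 1 < s) (hfrob : ∀ a b : K[X], (a + b) ^ s = a ^ s + b ^ s)
    (hK : Fintype.card K = s ^ 3) :
    {x : K | x * x ^ s + x + 1 = 0}.ncard = s + 1 := by
  classical
  set P : K[X] := X ^ (s + 1) + X + 1 with hP
  have hdeg : P.natDegree = s + 1 := by
    rw [hP]; compute_degree!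
    simp [show s ≠ 0 by omega]
  have hP0 : P ≠ 0 := by
    rintro h
    simp [h] at hdeg
  have hdvd : P ∣ X ^ (s ^ 2 + s + 1) - 1 := by
    have key : X * P ^ s - P = X ^ (s ^ 2 + s + 1) - 1 := by
      rw [hP, hfrob, hfrob, one_pow]
      ring
    rw [← key]
    exact dvd_sub ((dvd_pow_self P (by omega)).mul_left X) dvd_rfl
  have hexp : s ^ 3 = (s ^ 2 + s + 1) * (s - 1) + 1 := by
    obtain ⟨t, rfl⟩ : ∃ t, s = t + 1 := ⟨s - 1, by omega⟩
    simp only [Nat.add_sub_cancel]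
    ring
  have hdvd' : P ∣ X ^ Fintype.card K - X := by
    have h : (X : K[X]) ^ Fintype.card K - X
        = ((X ^ (s ^ 2 + s + 1)) ^ (s - 1) - 1) * X := by
      rw [hK, hexp, pow_succ, pow_mul]; ring
    rw [h]
    exact (hdvd.trans (sub_one_dvd_pow_sub_one _ _)).mul_right X
  have hne : (X : K[X]) ^ Fintype.card K - X ≠ 0 :=
    FiniteField.X_pow_card_sub_X_ne_zero K Fintype.one_lt_card
  have hsplit : (X ^ Fintype.card K - X : K[X]).Splits := by
    rw [splits_iff_card_roots, FiniteField.roots_X_pow_card_sub_X,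
      FiniteField.X_pow_card_sub_X_natDegree_eq K Fintype.one_lt_card]
    rfl
  have hcard : P.roots.card = s + 1 := by
    rw [← hdeg]
    exact splits_iff_card_roots.1 (hsplit.of_dvd hne hdvd')
  have hnodup : P.roots.Nodup := by
    refine Multiset.nodup_of_le (roots.le_of_dvd hne hdvd') ?_
    rw [FiniteField.roots_X_pow_card_sub_X]
    exact Finset.univ.nodup
  have hset : {x : K | x * x ^ s + x + 1 = 0} = (P.roots.toFinset : Set K) := by
    ext x
    simp only [Set.mem_ofPred_eq, Finset.mem_coe, Multiset.mem_toFinset, mem_roots hP0, IsRoot.def]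
    simp [hP, pow_succ']
  rw [hset, Set.ncard_coe_finset, Multiset.toFinset_card_of_nodup hnodup, hcard]

/-- An automorphism of order `3` of a finite field with `q ^ (3 * m)` elements is one of the two
nontrivial powers of the `q ^ m`-power map. -/
theorem eq_pow_or_eq_pow_sq_of_orderOf_eq_three {F K : Type*} [Field F] [Fintype F] [Field K]
    [Fintype K] [Algebra F K] {m : ℕ} (hK : Fintype.card K = Fintype.card F ^ (3 * m))
    (θ : K ≃ₐ[F] K) (hθ : orderOf θ = 3) :
    (∀ x, θ x = x ^ Fintype.card F ^ m) ∨ ∀ x, θ x = x ^ Fintype.card F ^ (2 * m) := by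
  have hrank : Module.finrank F K = 3 * m := by
    have h := Module.card_eq_pow_finrank (K := F) (V := K)
    rw [hK] at h
    exact (Nat.pow_right_injective Fintype.one_lt_card h).symm
  obtain ⟨⟨n, hn⟩, rfl⟩ := (FiniteField.bijective_frobeniusAlgEquivOfAlgebraic_pow F K).2 θ
  have hdvd : 3 * m ∣ n * 3 := by
    rw [← hrank, ← FiniteField.orderOf_frobeniusAlgEquivOfAlgebraic F K, orderOf_dvd_iff_pow_eq_one,
      pow_mul]
    exact hθ ▸ pow_orderOf_eq_one _
  obtain ⟨j, rfl⟩ : m ∣ n := by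
    rw [mul_comm n] at hdvd
    exact Nat.dvd_of_mul_dvd_mul_left (by norm_num) hdvd
  rw [hrank, mul_comm] at hn
  have hj : j < 3 := by
    by_contra! h
    nlinarith
  have happly (k : ℕ) (x : K) : (FiniteField.frobeniusAlgEquivOfAlgebraic F K ^ k) x
      = x ^ Fintype.card F ^ k := by
    rw [AlgEquiv.coe_pow, FiniteField.coe_frobeniusAlgEquivOfAlgebraic_iterate]
  interval_cases j
  · simp at hθ
  · exact Or.inl fun x => by simpa using happly m x
  · exact Or.inr fun x => by simpa [mul_comm] using happly (m * 2) x

section OrderThree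

variable {K : Type*} [Field K] {θ : K →+* K}

/-- Solutions of `γ * θ γ + γ + 1 = 0` have norm one. -/
theorem mul_map_mul_map_map_eq_one {γ : K} (h : γ * θ γ + γ + 1 = 0) : γ * θ γ * θ (θ γ) = 1 := by
  have h' := congrArg θ h
  simp only [map_add, map_mul, map_one, map_zero] at h'
  linear_combination γ * h' - h

theorem ncard_norm_one_left (hθ : ∀ x, θ (θ (θ x)) = x) {β : K}
    (hβ : β * θ β * θ (θ β) = 1) :
    {α : K | α * θ α * θ (θ α) = 1 ∧ α * θ α * β + α * β * θ (θ β) + 1 = 0}.ncard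
      = {γ : K | γ * θ γ + γ + 1 = 0}.ncard := by
  have hne : θ β ≠ 0 := by
    rintro h
    simp [h] at hβ
  rw [← Set.ncard_image_of_injective {γ : K | γ * θ γ + γ + 1 = 0} (mul_left_injective₀ hne)]
  congr 1
  ext α
  simp only [Set.mem_ofPred_eq, Set.mem_image]
  constructor
  · rintro ⟨-, h⟩
    refine ⟨α * (β * θ (θ β)), ?_, by linear_combination α * hβ⟩
    simp only [map_mul, hθ]
    linear_combination h + α * θ α * β * hβ
  · rintro ⟨γ, h, rfl⟩
    have hγ := mul_map_mul_map_map_eq_one h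
    simp only [map_mul, hθ]
    constructor
    · linear_combination β * θ β * θ (θ β) * hγ + hβ
    · linear_combination h + (γ * θ γ + γ) * hβ

theorem ncard_norm_one_right (hθ : ∀ x, θ (θ (θ x)) = x) {α : K}
    (hα : α * θ α * θ (θ α) = 1) :
    {β : K | β * θ β * θ (θ β) = 1 ∧ α * θ α * β + α * β * θ (θ β) + 1 = 0}.ncard
      = {γ : K | γ * θ γ + γ + 1 = 0}.ncard := by
  have hne : α ≠ 0 := by
    rintro rfl
    simp at hα
  have hinj : Function.Injective fun γ => θ (θ (α * γ⁻¹)) :=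
    θ.injective.comp <| θ.injective.comp <| (mul_right_injective₀ hne).comp inv_injective
  rw [← Set.ncard_image_of_injective {γ : K | γ * θ γ + γ + 1 = 0} hinj]
  congr 1
  ext β
  simp only [Set.mem_ofPred_eq, Set.mem_image]
  constructor
  · rintro ⟨hβ, h⟩
    refine ⟨α * (β * θ (θ β)), ?_, ?_⟩
    · simp only [map_mul, hθ]
      linear_combination h + α * θ α * β * hβ
    · have hinv : (β * θ (θ β))⁻¹ = θ β :=
        inv_eq_of_mul_eq_one_right (by linear_combination hβ)
      rw [mul_inv, hinv, mul_inv_cancel_left₀ hne, hθ]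
  · rintro ⟨γ, h, rfl⟩
    have hγ := mul_map_mul_map_map_eq_one h
    have hinv : γ⁻¹ = θ γ * θ (θ γ) := by
      refine inv_eq_of_mul_eq_one_right ?_
      rw [← mul_assoc, hγ]
    simp only [hinv, map_mul, hθ]
    constructor
    · linear_combination (γ * θ γ * θ (θ γ)) ^ 2 * hα + (γ * θ γ * θ (θ γ) + 1) * hγ
    · linear_combination h + (γ * θ γ + γ) * hα
        + α * θ α * θ (θ α) * γ * hγ

/-- Inversion exchanges the solutions for `θ` and for `θ⁻¹ = θ ^ 2`. -/
theorem ncard_eq_ncard_map_map (hθ : ∀ x, θ (θ (θ x)) = x) :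
    {γ : K | γ * θ γ + γ + 1 = 0}.ncard = {γ : K | γ * θ (θ γ) + γ + 1 = 0}.ncard := by
  rw [← Set.ncard_image_of_injective {γ : K | γ * θ γ + γ + 1 = 0} inv_injective]
  congr 1
  ext η
  simp only [Set.mem_ofPred_eq, Set.mem_image]
  constructor
  · rintro ⟨γ, h, rfl⟩
    have hγ := mul_map_mul_map_map_eq_one h
    have hinv : γ⁻¹ = θ γ * θ (θ γ) := by
      refine inv_eq_of_mul_eq_one_right ?_
      rw [← mul_assoc, hγ]
    simp only [hinv, map_mul, hθ]
    have h' := congrArg θ h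
    simp only [map_add, map_mul, map_one, map_zero] at h'
    linear_combination h' + θ γ * hγ
  · intro h
    have h' := congrArg θ h
    simp only [map_add, map_mul, map_one, map_zero, hθ] at h'
    have hη : η ≠ 0 := by
      rintro rfl
      simp at h
    have hη' : θ η ≠ 0 := by simpa using hη
    refine ⟨η⁻¹, ?_, inv_inv η⟩
    rw [map_inv₀]
    field_simp
    linear_combination h'

end OrderThree

/-- The count for an automorphism of the field with `s ^ 3` elements acting as the `s`-power or the
`s ^ 2`-power map. -/
theorem ncard_mul_map_add_add_one {K : Type*} [Field K] [Fintype K] {s p n : ℕ} [Fact p.Prime]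
    [CharP K p] (hsp : s = p ^ n) (hs : 1 < s) (hK : Fintype.card K = s ^ 3) {θ : K →+* K}
    (hθ : ∀ x, θ (θ (θ x)) = x) (hpow : (∀ x, θ x = x ^ s) ∨ ∀ x, θ x = x ^ s ^ 2) :
    {γ : K | γ * θ γ + γ + 1 = 0}.ncard = s + 1 := by
  have hroots := ncard_roots_trinomial hs
    (fun a b => by rw [hsp, add_pow_char_pow]) hK
  rcases hpow with h | h
  · simpa only [h] using hroots
  · have h2 (x : K) : θ (θ x) = x ^ s := by
      rw [h, h, ← pow_mul, show s ^ 2 * s ^ 2 = s ^ 3 * s by ring, pow_mul, ← hK,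
        FiniteField.pow_card]
    rw [ncard_eq_ncard_map_map hθ]
    simpa only [h2] using hroots

/-- For each fixed `β ∈ 𝒢`, the number of `α ∈ 𝒢` with
`α·θ(α)·β + α·β·θ²(β) + 1 = 0` (equivalently, the number of codes `C_{2,α}`
containing `C_{1,β}`) is exactly `q^{d/3} + 1`; symmetrically, for each fixed
`α ∈ 𝒢` the number of `β ∈ 𝒢` satisfying the same equation (the number of
codes `C_{1,β}` contained in `C_{2,α}`) is exactly `q^{d/3} + 1`. -/
theorem stmt_14 (q d : ℕ) (hq : IsPrimePow q) (hd : 0 < d) (hd3 : 3 ∣ d)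
    (F K : Type*) [Field F] [Fintype F] [Field K] [Fintype K] [Algebra F K]
    (hF : Fintype.card F = q) (hK : Fintype.card K = q ^ d)
    (θ : K ≃ₐ[F] K) (hθ : orderOf θ = 3) :
    (∀ β : K, β ≠ 0 → β ^ (1 + q ^ (d / 3) + q ^ (2 * (d / 3))) = 1 →
      ({α : K | (α ≠ 0 ∧ α ^ (1 + q ^ (d / 3) + q ^ (2 * (d / 3))) = 1) ∧
          α * θ α * β + α * β * θ (θ β) + 1 = 0}).ncard = q ^ (d / 3) + 1) ∧
    (∀ α : K, α ≠ 0 → α ^ (1 + q ^ (d / 3) + q ^ (2 * (d / 3))) = 1 →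
      ({β : K | (β ≠ 0 ∧ β ^ (1 + q ^ (d / 3) + q ^ (2 * (d / 3))) = 1) ∧
          α * θ α * β + α * β * θ (θ β) + 1 = 0}).ncard = q ^ (d / 3) + 1) := by
  obtain ⟨m, rfl⟩ := hd3
  have hm : 0 < m := by omega
  rw [Nat.mul_div_cancel_left m (by norm_num)]
  subst hF
  obtain ⟨p, _⟩ := CharP.exists F
  have : CharP K p := charP_of_injective_algebraMap (algebraMap F K).injective p
  obtain ⟨n, hp, hn⟩ := FiniteField.card F p
  have : Fact p.Prime := ⟨hp⟩
  have hpow := eq_pow_or_eq_pow_sq_of_orderOf_eq_three hK θ hθ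
  have hθ3 (x : K) : θ (θ (θ x)) = x := by
    have h : θ ^ 3 = 1 := hθ ▸ pow_orderOf_eq_one θ
    simpa [pow_succ] using DFunLike.congr_fun h x
  set s := Fintype.card F ^ m with hs
  have hsq : Fintype.card F ^ (2 * m) = s ^ 2 := by rw [hs, ← pow_mul, mul_comm]
  have hK' : Fintype.card K = s ^ 3 := by rw [hK, hs, ← pow_mul, mul_comm]
  rw [hsq] at hpow ⊢
  have hnorm (x : K) :
      (x ≠ 0 ∧ x ^ (1 + s + s ^ 2) = 1) ↔ x * θ x * θ (θ x) = 1 := by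
    have h : x ^ (1 + s + s ^ 2) = x * θ x * θ (θ x) := by
      rcases hpow with h | h
      · rw [h, h]; ring
      · have h2 : θ (θ x) = x ^ s := by
          rw [h, h, ← pow_mul, show s ^ 2 * s ^ 2 = s ^ 3 * s by ring, pow_mul, ← hK',
            FiniteField.pow_card]
        rw [h2, h]; ring
    rw [h, and_iff_right_iff_imp]
    rintro h1 rfl
    simp at h1
  have hcount := ncard_mul_map_add_add_one (θ := (θ : K →+* K)) (p := p) (n := n * m)
    (by rw [hn, pow_mul]) (Nat.one_lt_pow hm.ne' Fintype.one_lt_card) hK' hθ3 hpow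
  simp only [hnorm]
  refine ⟨fun β hβ0 hβ => ?_, fun α hα0 hα => ?_⟩
  · exact (ncard_norm_one_left (θ := (θ : K →+* K)) hθ3 ((hnorm β).1 ⟨hβ0, hβ⟩)).trans hcount
  · exact (ncard_norm_one_right (θ := (θ : K →+* K)) hθ3 ((hnorm α).1 ⟨hα0, hα⟩)).trans hcount
end

section
/- Let 𝒥₁ be the set of q-cyclotomic cosets J modulo m such that rj ≡ j (mod m) for all j ∈ J, and let 𝒥₂ be the set of all remaining q-cyclotomic cosets modulo m (each J ∈ 𝒥₂ has |J| divisible by 3). Let δ = |{J ∈ 𝒥₁ : q^{|J|} ≡ 1 (mod 3)}|. Then the number of left ideals of the group algebra 𝔽_q[G_{(m,3,r)}] equals 2^δ · 4^{|𝒥₁|} · ∏_{J∈𝒥₂} (4 + 2·q^{|J|/3} + 2·q^{2|J|/3}); in particular, when q ≡ 0 (mod 3) one has δ = 0 and the count is 4^{|𝒥₁|} · ∏_{J∈𝒥₂} (4 + 2·q^{|J|/3} + 2·q^{2|J|/3}). -/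
open scoped BigOperators

/-- Left ideals of a full matrix ring over a commutative ring correspond to submodules of the row
space. -/
def Matrix.leftIdealEquivSubmodule (n K : Type*) [Fintype n] [DecidableEq n] [CommRing K] :
    Ideal (Matrix n n K) ≃ Submodule K (n → K) where
  toFun I :=
    { carrier := {v | ∀ w, Matrix.vecMulVec w v ∈ I}
      add_mem' := fun ha hb w => by
        rw [Matrix.vecMulVec_add]
        exact I.add_mem (ha w) (hb w)
      zero_mem' := fun w => by simp
      smul_mem' := fun c v hv w => by
        rw [Matrix.vecMulVec_smul, ← Matrix.smul_vecMulVec]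
        exact hv _ }
  invFun W :=
    { carrier := {M | ∀ i, M i ∈ W}
      add_mem' := fun ha hb i => W.add_mem (ha i) (hb i)
      zero_mem' := fun i => W.zero_mem
      smul_mem' := fun A M hM i => by
        have : (A • M) i = ∑ j, A i j • M j := by
          ext k
          simp [Matrix.mul_apply]
        rw [this]
        exact W.sum_mem fun j _ => W.smul_mem _ (hM j) }
  left_inv I := by
    ext M
    refine ⟨fun h => ?_, fun h i w => ?_⟩
    · have : M = ∑ i, Matrix.vecMulVec (Pi.single i 1) (M i) := by
        ext a b
        simp [Matrix.sum_apply, Matrix.vecMulVec_apply, Pi.single_apply]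
      rw [this]
      exact I.sum_mem fun i _ => h i _
    · have : Matrix.vecMulVec w (M i) = Matrix.vecMulVec w (Pi.single i 1) * M := by
        rw [Matrix.vecMulVec_mul, Matrix.single_one_vecMul]
        rfl
      rw [this]
      exact I.mul_mem_left _ h
  right_inv W := by
    ext v
    refine ⟨fun h => ?_, fun h w i => W.smul_mem (w i) h⟩
    cases isEmpty_or_nonempty n with
    | inl _ => rw [Subsingleton.elim v 0]; exact W.zero_mem
    | inr hn =>
      obtain ⟨i⟩ := hn
      have := h (Pi.single i 1) i
      have h2 : Matrix.vecMulVec (Pi.single i 1) v i = v := by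
        ext b
        simp [Matrix.vecMulVec_apply]
      rwa [h2] at this

theorem card_submodule_finrank_one (K V : Type*) [Field K] [Finite K] [AddCommGroup V]
    [Module K V] (hV : Module.finrank K V = 3) :
    Nat.card {W : Submodule K V // Module.finrank K W = 1} =
      1 + Nat.card K + Nat.card K ^ 2 := by
  rw [← Nat.card_congr (Projectivization.equivSubmodule K V),
    Projectivization.card_of_finrank K V hV]
  simp [Finset.sum_range_succ]

theorem card_submodule_finrank_two (K V : Type*) [Field K] [Finite K] [AddCommGroup V]
    [Module K V] (hV : Module.finrank K V = 3) :
    Nat.card {W : Submodule K V // Module.finrank K W = 2} =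
      1 + Nat.card K + Nat.card K ^ 2 := by
  have : FiniteDimensional K V := FiniteDimensional.of_finrank_pos (by omega)
  rw [← card_submodule_finrank_one K (Module.Dual K V) (by rw [Subspace.dual_finrank_eq, hV])]
  refine Nat.card_congr (Equiv.subtypeEquiv
    ((Subspace.orderIsoFiniteDimensional (K := K) (V := V)).toEquiv.trans OrderDual.ofDual) ?_)
  intro W
  have := Subspace.finrank_add_finrank_dualAnnihilator_eq W
  have h2 : Module.finrank K ((Subspace.orderIsoFiniteDimensional.toEquiv.trans
    OrderDual.ofDual) W : Submodule K (Module.Dual K V)) = Module.finrank K W.dualAnnihilator := rfl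
  rw [h2]
  omega

theorem card_submodule_of_finrank_eq_three (K V : Type*) [Field K] [Finite K] [AddCommGroup V]
    [Module K V] (hV : Module.finrank K V = 3) :
    Nat.card (Submodule K V) = 4 + 2 * Nat.card K + 2 * Nat.card K ^ 2 := by
  have : FiniteDimensional K V := FiniteDimensional.of_finrank_pos (by omega)
  have : Finite V := Module.finite_of_finite K
  let f : Submodule K V → Fin 4 := fun W =>
    ⟨Module.finrank K W, by have := Submodule.finrank_le W; omega⟩
  rw [← Nat.card_congr (Equiv.sigmaFiberEquiv f), Nat.card_sigma, Fin.sum_univ_four]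
  have e (i : Fin 4) : Nat.card {W : Submodule K V // f W = i} =
      Nat.card {W : Submodule K V // Module.finrank K W = i} :=
    Nat.card_congr (Equiv.subtypeEquivRight fun W => by simp [f, Fin.ext_iff])
  simp only [e]
  have h0 : Nat.card {W : Submodule K V // Module.finrank K W = 0} = 1 := by
    simp only [Submodule.finrank_eq_zero]
    simp
  have h3 : Nat.card {W : Submodule K V // Module.finrank K W = 3} = 1 := by
    have (W : Submodule K V) : Module.finrank K W = 3 ↔ W = ⊤ := by
      rw [← hV]
      exact ⟨Submodule.eq_top_of_finrank_eq, fun h => by rw [h, finrank_top]⟩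
    simp only [this]
    simp
  have h1 := card_submodule_finrank_one K V hV
  have h2 := card_submodule_finrank_two K V hV
  simp only [Fin.val_zero, Fin.val_one, Fin.val_two, show ((3 : Fin 4) : ℕ) = 3 from rfl]
  rw [h0, h1, h2, h3]
  ring

/-- Left ideals are transported along ring isomorphisms. -/
theorem RingEquiv.card_ideal_eq {R S : Type*} [Ring R] [Ring S] (e : R ≃+* S) :
    Nat.card (Ideal R) = Nat.card (Ideal S) :=
  Nat.card_congr
    { toFun := Ideal.comap e.symm
      invFun := Ideal.comap e
      left_inv := fun I => by
        ext a
        rw [Ideal.mem_comap, Ideal.mem_comap, RingEquiv.symm_apply_apply]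
      right_inv := fun I => by
        ext a
        rw [Ideal.mem_comap, Ideal.mem_comap, RingEquiv.apply_symm_apply] }

theorem card_ideal_end_of_finrank_eq_three (K V : Type*) [Field K] [Finite K] [AddCommGroup V]
    [Module K V] (hV : Module.finrank K V = 3) :
    Nat.card (Ideal (Module.End K V)) = 4 + 2 * Nat.card K + 2 * Nat.card K ^ 2 := by
  have : FiniteDimensional K V := FiniteDimensional.of_finrank_pos (by omega)
  let b := Module.finBasisOfFinrankEq K V hV
  rw [(LinearMap.toMatrixAlgEquiv b).toRingEquiv.card_ideal_eq,
    Nat.card_congr (Matrix.leftIdealEquivSubmodule (Fin 3) K)]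
  exact card_submodule_of_finrank_eq_three K _ (by simp)

theorem card_end_of_finrank_eq_three (K V : Type*) [Field K] [Finite K] [AddCommGroup V]
    [Module K V] (hV : Module.finrank K V = 3) :
    Nat.card (Module.End K V) = Nat.card V ^ 3 := by
  have : FiniteDimensional K V := FiniteDimensional.of_finrank_pos (by omega)
  let b := Module.finBasisOfFinrankEq K V hV
  rw [← Nat.card_congr (b.constr K).toEquiv, Nat.card_fun]
  simp

open UniqueFactorizationMonoid in
theorem Ideal.card_dvd_multiset_prod {R : Type*} [CommRing R] [IsDedekindDomain R]
    [DecidableEq (Ideal R)] {s : Multiset (Ideal R)} (hs : ∀ P ∈ s, Prime P) :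
    Nat.card {J : Ideal R // J ∣ s.prod} = ∏ P ∈ s.toFinset, (s.count P + 1) := by
  have h0 : s.prod ≠ 0 := fun h => (hs 0 (Multiset.prod_eq_zero_iff.1 h)).ne_zero rfl
  rw [← Multiset.card_Iic, ← Nat.card_eq_finsetCard]
  refine Nat.card_congr
    { toFun := fun J => ⟨normalizedFactors J.1, ?_⟩
      invFun := fun t => ⟨t.1.prod, Multiset.prod_dvd_prod_of_le (Finset.mem_Iic.1 t.2)⟩
      left_inv := fun J => ?_
      right_inv := fun t => ?_ }
  · have h := (dvd_iff_normalizedFactors_le_normalizedFactors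
      (ne_zero_of_dvd_ne_zero h0 J.2) h0).1 J.2
    rwa [normalizedFactors_prod_of_prime hs, ← Finset.mem_Iic] at h
  · exact Subtype.ext (associated_iff_eq.1
      (prod_normalizedFactors (ne_zero_of_dvd_ne_zero h0 J.2)))
  · exact Subtype.ext (normalizedFactors_prod_of_prime fun P hP =>
      hs P (Multiset.mem_of_le (Finset.mem_Iic.1 t.2) hP))

open Polynomial

theorem AdjoinRoot.card_ideal {K : Type*} [Field K] (p : K[X]) :
    Nat.card (Ideal (AdjoinRoot p)) = Nat.card {J : Ideal K[X] // J ∣ Ideal.span {p}} := by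
  refine Nat.card_congr ((Ideal.relIsoOfSurjective (Ideal.Quotient.mk (Ideal.span {p}))
    Ideal.Quotient.mk_surjective).toEquiv.trans (Equiv.subtypeEquivRight fun J => ?_))
  rw [Ideal.dvd_iff_le, ← RingHom.ker_eq_comap_bot, Ideal.mk_ker]

theorem AdjoinRoot.card_ideal_multiset_prod {K : Type*} [Field K] [DecidableEq (Ideal K[X])]
    (s : Multiset K[X]) (hs : ∀ p ∈ s, Irreducible p) :
    Nat.card (Ideal (AdjoinRoot s.prod)) =
      ∏ P ∈ (s.map fun p => Ideal.span {p}).toFinset,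
        ((s.map fun p => Ideal.span {p}).count P + 1) := by
  rw [AdjoinRoot.card_ideal, ← Ideal.card_dvd_multiset_prod, Ideal.multiset_prod_span_singleton]
  intro P hP
  obtain ⟨p, hp, rfl⟩ := Multiset.mem_map.1 hP
  exact Ideal.prime_span_singleton_iff.2 (hs p hp).prime

theorem span_ne_span_of_monic {K : Type*} [Field K] {p q : K[X]} (hp : p.Monic) (hq : q.Monic)
    (h : p ≠ q) : Ideal.span {p} ≠ Ideal.span {q} := fun e =>
  h (eq_of_monic_of_associated hp hq (Ideal.span_singleton_eq_span_singleton.1 e))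

theorem card_ideal_adjoinRoot_X_pow_three_sub_one (K : Type*) [Field K] [Finite K] :
    Nat.card (Ideal (AdjoinRoot (X ^ 3 - 1 : K[X]))) =
      if Nat.card K % 3 = 1 then 8 else 4 := by
  classical
  have := Fintype.ofFinite K
  split_ifs with h
  · obtain ⟨w, hw, hw1⟩ : ∃ w : K, w ^ 2 + w + 1 = 0 ∧ w ≠ 1 := by
      have : Fact (Nat.Prime 3) := ⟨Nat.prime_three⟩
      have h3 : 3 ∣ Nat.card Kˣ := by
        rw [Nat.card_units]; omega
      obtain ⟨w, hw⟩ := exists_prime_orderOf_dvd_card' 3 h3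
      have hw1 : (w : K) ≠ 1 := fun e => by
        rw [Units.val_eq_one.1 e, orderOf_one] at hw
        omega
      have hw3 : (w : K) ^ 3 = 1 := by
        rw [← Units.val_pow_eq_pow_val, ← hw, pow_orderOf_eq_one, Units.val_one]
      refine ⟨w, ?_, hw1⟩
      have : ((w : K) - 1) * ((w : K) ^ 2 + w + 1) = 0 := by linear_combination hw3
      exact (mul_eq_zero.1 this).resolve_left (sub_ne_zero.2 hw1)
    have hw2 : w ^ 2 ≠ 1 := fun e => hw1 <| by
      have h1 : w ^ 3 = 1 := by linear_combination (w - 1) * hw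
      linear_combination h1 - w * e
    have hw3 : w ^ 2 ≠ w := fun e => by
      have h0 : w * (w - 1) = 0 := by linear_combination e
      rcases mul_eq_zero.1 h0 with h0 | h0
      · simp [h0] at hw
      · exact hw1 (sub_eq_zero.1 h0)
    have hs : (X ^ 3 - 1 : K[X]) =
        Multiset.prod {X - C 1, X - C w, X - C (w ^ 2)} := by
      have hc : (C w ^ 2 + C w + 1 : K[X]) = 0 := by
        simpa using congrArg C hw
      simp only [Multiset.insert_eq_cons, Multiset.prod_cons, Multiset.prod_singleton, map_pow,
        map_one]
      linear_combination (X ^ 2 - C w * X + C w - 1) * hc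
    rw [hs, AdjoinRoot.card_ideal_multiset_prod _ (by
      simp only [Multiset.insert_eq_cons, Multiset.mem_cons, Multiset.mem_singleton]
      rintro p (rfl | rfl | rfl) <;> exact irreducible_X_sub_C _)]
    have hne {a b : K} (hab : a ≠ b) : Ideal.span {X - C a} ≠ Ideal.span {X - C b} :=
      span_ne_span_of_monic (monic_X_sub_C a) (monic_X_sub_C b)
        fun e => hab (C_injective (sub_right_injective e))
    have h1 := hne hw1
    have h2 := hne hw2
    have h3 := hne hw3
    have hnd : (Multiset.map (fun p : K[X] => Ideal.span {p})
        {X - C 1, X - C w, X - C (w ^ 2)}).Nodup := by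
      simp only [Multiset.insert_eq_cons, Multiset.map_cons, Multiset.map_singleton,
        Multiset.nodup_cons, Multiset.mem_cons, Multiset.mem_singleton, not_or]
      exact ⟨⟨h1.symm, h2.symm⟩, h3.symm, Multiset.nodup_singleton _⟩
    rw [Finset.prod_congr rfl fun P hP => by
      rw [Multiset.count_eq_one_of_mem hnd (Multiset.mem_toFinset.1 hP)], Finset.prod_const,
      Multiset.toFinset_card_of_nodup hnd]
    rfl
  · have hroot (w : K) (hw : w ^ 2 + w + 1 = 0) : w = 1 := by
      by_contra hw1
      have h3 : w ^ 3 = 1 := by linear_combination (w - 1) * hw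
      have := orderOf_eq_prime (p := 3) h3 hw1
      have hd := orderOf_dvd_natCard (G := Kˣ) (Units.mk0 w fun h0 => by simp [h0] at hw)
      rw [← orderOf_units, Units.val_mk0, this, Nat.card_units] at hd
      have := Nat.card_pos (α := K)
      omega
    by_cases h30 : (3 : K) = 0
    · have hs : (X ^ 3 - 1 : K[X]) = Multiset.prod (Multiset.replicate 3 (X - C 1)) := by
        have hc : (3 : K[X]) = 0 := by
          simpa only [map_ofNat, map_zero] using congrArg C h30
        simp only [Multiset.prod_replicate, map_one]
        linear_combination (X ^ 2 - X) * hc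
      rw [hs, AdjoinRoot.card_ideal_multiset_prod _ (fun p hp => by
        rw [Multiset.eq_of_mem_replicate hp]; exact irreducible_X_sub_C _)]
      rw [Multiset.map_replicate, Multiset.toFinset_replicate]
      simp
    · have hmon : (X ^ 2 + X + 1 : K[X]).Monic := by monicity!
      have hdeg : (X ^ 2 + X + 1 : K[X]).natDegree = 2 := by compute_degree!
      have hirr : Irreducible (X ^ 2 + X + 1 : K[X]) := by
        refine (hmon.irreducible_iff_roots_eq_zero_of_degree_le_three hdeg.ge (by omega)).2 ?_
        refine Multiset.eq_zero_of_forall_notMem fun w hw => ?_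
        have hw0 : w ^ 2 + w + 1 = 0 := by
          simpa using (mem_roots'.1 hw).2
        have := hroot w hw0
        subst this
        exact h30 (by linear_combination hw0)
      have hs : (X ^ 3 - 1 : K[X]) = Multiset.prod {X - C 1, X ^ 2 + X + 1} := by
        simp only [Multiset.insert_eq_cons, Multiset.prod_cons, Multiset.prod_singleton, map_one]
        ring
      rw [hs, AdjoinRoot.card_ideal_multiset_prod _ (by
        simp only [Multiset.insert_eq_cons, Multiset.mem_cons, Multiset.mem_singleton]
        rintro p (rfl | rfl)
        exacts [irreducible_X_sub_C _, hirr])]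
      have hnd : (Multiset.map (fun p : K[X] => Ideal.span {p})
          {X - C 1, X ^ 2 + X + 1}).Nodup := by
        simp only [Multiset.insert_eq_cons, Multiset.map_cons, Multiset.map_singleton,
          Multiset.nodup_cons, Multiset.mem_singleton]
        refine ⟨span_ne_span_of_monic (monic_X_sub_C 1) hmon fun e => ?_,
          Multiset.nodup_singleton _⟩
        have := congrArg natDegree e
        rw [natDegree_X_sub_C, hdeg] at this
        omega
      rw [Finset.prod_congr rfl fun P hP => by
        rw [Multiset.count_eq_one_of_mem hnd (Multiset.mem_toFinset.1 hP)], Finset.prod_const,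
        Multiset.toFinset_card_of_nodup hnd]
      rfl

theorem card_adjoinRoot_X_pow_three_sub_one (K : Type*) [Field K] [Finite K] :
    Nat.card (AdjoinRoot (X ^ 3 - 1 : K[X])) = Nat.card K ^ 3 := by
  have hm : (X ^ 3 - 1 : K[X]).Monic := by monicity!
  have hd : (X ^ 3 - 1 : K[X]).natDegree = 3 := by compute_degree!
  have := hm.finite_adjoinRoot
  have := Module.natCard_eq_pow_finrank (K := K) (V := AdjoinRoot (X ^ 3 - 1 : K[X]))
  rw [this, (AdjoinRoot.powerBasis' hm).finrank, AdjoinRoot.powerBasis'_dim, hd]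

section Metacyclic

theorem pow_mul_pow_mul_of_mul_eq {M : Type*} [Monoid M] {u v : M} {r : ℕ}
    (h : v * u = u ^ r * v) (i j k l : ℕ) :
    u ^ i * v ^ j * (u ^ k * v ^ l) = u ^ (i + r ^ j * k) * v ^ (j + l) := by
  have h1 (k : ℕ) : v * u ^ k = u ^ (r * k) * v := by
    have : SemiconjBy v u (u ^ r) := h
    rw [pow_mul]
    exact this.pow_right k
  have h2 (j : ℕ) : ∀ k, v ^ j * u ^ k = u ^ (r ^ j * k) * v ^ j := by
    induction j with
    | zero => simp
    | succ j ih =>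
      intro k
      rw [pow_succ, mul_assoc, h1, ← mul_assoc, ih, mul_assoc, ← mul_assoc (r ^ j), ← pow_succ r]
  rw [mul_assoc, ← mul_assoc (v ^ j), h2, mul_assoc, ← mul_assoc, ← pow_add, pow_add v]

variable {G : Type*} [Group G] {x y : G} {m r : ℕ}

theorem exists_eq_pow_mul_pow_of_closure [Finite G] (hyx : y * x = x ^ r * y)
    (hgen : ∀ g : G, g ∈ Subgroup.closure ({x, y} : Set G)) (g : G) :
    ∃ i j : ℕ, g = x ^ i * y ^ j := by
  have hmul (g h : G) (hg : ∃ i j : ℕ, g = x ^ i * y ^ j) (hh : ∃ i j : ℕ, h = x ^ i * y ^ j) :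
      ∃ i j : ℕ, g * h = x ^ i * y ^ j := by
    obtain ⟨i, j, rfl⟩ := hg
    obtain ⟨k, l, rfl⟩ := hh
    exact ⟨_, _, pow_mul_pow_mul_of_mul_eq hyx i j k l⟩
  induction hgen g using Subgroup.closure_induction with
  | mem g hg =>
    rcases hg with rfl | rfl
    · exact ⟨1, 0, by simp⟩
    · exact ⟨0, 1, by simp⟩
  | one => exact ⟨0, 0, by simp⟩
  | mul g h _ _ ihg ihh => exact hmul g h ihg ihh
  | inv g _ ih =>
    have hpow (n : ℕ) : ∃ i j : ℕ, g ^ n = x ^ i * y ^ j := by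
      induction n with
      | zero => exact ⟨0, 0, by simp⟩
      | succ n ihn => rw [pow_succ]; exact hmul _ _ ihn ih
    obtain ⟨n, hn⟩ := (isOfFinOrder_of_finite g).mem_powers_iff_mem_zpowers.2
      (Subgroup.inv_mem _ (Subgroup.mem_zpowers g))
    rw [← hn]
    exact hpow n

theorem bijective_pow_mul_pow [Fintype G] [NeZero m] (hx : orderOf x = m) (hy : orderOf y = 3)
    (hyx : y * x = x ^ r * y) (hcard : Fintype.card G = 3 * m)
    (hgen : ∀ g : G, g ∈ Subgroup.closure ({x, y} : Set G)) :
    Function.Bijective fun p : Fin m × Fin 3 => x ^ (p.1 : ℕ) * y ^ (p.2 : ℕ) := by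
  rw [Fintype.bijective_iff_surjective_and_card]
  refine ⟨fun g => ?_, by simp [hcard, mul_comm]⟩
  obtain ⟨i, j, rfl⟩ := exists_eq_pow_mul_pow_of_closure hyx hgen g
  refine ⟨(Fin.ofNat m i, Fin.ofNat 3 j), ?_⟩
  simp only [Fin.val_ofNat]
  rw [← hx, pow_mod_orderOf, ← hy, pow_mod_orderOf]

/-- The universal property of the metacyclic presentation. -/
theorem exists_monoidHom_of_bijective [NeZero m] (hx : orderOf x = m) (hy : orderOf y = 3)
    (hyx : y * x = x ^ r * y)
    (hb : Function.Bijective fun p : Fin m × Fin 3 => x ^ (p.1 : ℕ) * y ^ (p.2 : ℕ))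
    {M : Type*} [Monoid M] {u v : M} (hu : u ^ m = 1) (hv : v ^ 3 = 1)
    (hvu : v * u = u ^ r * v) :
    ∃ f : G →* M, ∀ i j : ℕ, f (x ^ i * y ^ j) = u ^ i * v ^ j := by
  let e := Equiv.ofBijective _ hb
  let f : G → M := fun g => u ^ ((e.symm g).1 : ℕ) * v ^ ((e.symm g).2 : ℕ)
  have hf (i j : ℕ) : f (x ^ i * y ^ j) = u ^ i * v ^ j := by
    have : e.symm (x ^ i * y ^ j) = (Fin.ofNat m i, Fin.ofNat 3 j) := by
      rw [Equiv.symm_apply_eq]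
      simp only [e, Equiv.ofBijective_apply, Fin.val_ofNat]
      rw [← pow_mod_orderOf x, hx, ← pow_mod_orderOf y, hy]
    simp only [f, this, Fin.val_ofNat]
    rw [← pow_eq_pow_mod i hu, ← pow_eq_pow_mod j hv]
  refine ⟨⟨⟨f, ?_⟩, ?_⟩, hf⟩
  · simpa using hf 0 0
  · intro g h
    obtain ⟨⟨i, j⟩, rfl⟩ := e.surjective g
    obtain ⟨⟨k, l⟩, rfl⟩ := e.surjective h
    simp only [e, Equiv.ofBijective_apply]
    rw [pow_mul_pow_mul_of_mul_eq hyx, hf, hf, hf, pow_mul_pow_mul_of_mul_eq hvu]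

variable {F L : Type*} [Field F] [Field L] [Algebra F L]

/-- The polynomial `∑ i, a (x ^ i * y ^ j) X ^ i` evaluated at `z`. -/
noncomputable def sliceEval (x y : G) (m : ℕ) (a : MonoidAlgebra F G) (j : ℕ) (z : L) : L :=
  ∑ i : Fin m, algebraMap F L (a.coeff (x ^ (i : ℕ) * y ^ j)) * z ^ (i : ℕ)

theorem exists_algHom_of_bijective [NeZero m] (hx : orderOf x = m) (hy : orderOf y = 3)
    (hyx : y * x = x ^ r * y)
    (hb : Function.Bijective fun p : Fin m × Fin 3 => x ^ (p.1 : ℕ) * y ^ (p.2 : ℕ))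
    {B : Type*} [Ring B] [Algebra F B] (ι : L →ₐ[F] B) {z : L} {v : B} (hz : z ^ m = 1)
    (hv : v ^ 3 = 1) (hvz : v * ι z = ι z ^ r * v) :
    ∃ f : MonoidAlgebra F G →ₐ[F] B, ∀ a,
      f a = ∑ j : Fin 3, ι (sliceEval x y m a j z) * v ^ (j : ℕ) := by
  obtain ⟨f, hf⟩ := exists_monoidHom_of_bijective hx hy hyx hb (u := ι z) (v := v)
    (by rw [← map_pow, hz, map_one]) hv hvz
  refine ⟨MonoidAlgebra.lift F B G f, fun a => ?_⟩
  have : Fintype G := Fintype.ofBijective _ hb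
  rw [MonoidAlgebra.lift_apply, Finsupp.sum_fintype _ _ (by simp),
    ← (Equiv.ofBijective _ hb).sum_comp, Fintype.sum_prod_type, Finset.sum_comm]
  refine Finset.sum_congr rfl fun j _ => ?_
  rw [sliceEval, map_sum, Finset.sum_mul]
  refine Finset.sum_congr rfl fun i _ => ?_
  rw [Equiv.ofBijective_apply, hf, map_mul ι, AlgHom.commutes, map_pow, Algebra.smul_def, mul_assoc]

end Metacyclic

section Components

open Polynomial

variable {G : Type*} [Group G] {x y : G} {m r : ℕ}
variable {F : Type*} {L : Type*} [Field F] [Field L] [Algebra F L]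

/-- A fixed point `z` of `z ↦ z ^ r` yields a homomorphism from the group algebra to
`L[X] / (X ^ 3 - 1)` whose kernel consists of elements with slices vanishing at `z`. -/
theorem exists_component_of_pow_eq_self [NeZero m] (hx : orderOf x = m) (hy : orderOf y = 3)
    (hyx : y * x = x ^ r * y)
    (hb : Function.Bijective fun p : Fin m × Fin 3 => x ^ (p.1 : ℕ) * y ^ (p.2 : ℕ))
    {z : L} (hz : z ^ m = 1) (hzr : z ^ r = z) :
    ∃ f : MonoidAlgebra F G →+* AdjoinRoot (X ^ 3 - 1 : L[X]),
      ∀ a, f a = 0 → ∀ j : Fin 3, sliceEval x y m a j z = 0 := by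
  have hmon : (X ^ 3 - 1 : L[X]).Monic := by monicity!
  have hdeg : (X ^ 3 - 1 : L[X]).degree = 3 := by compute_degree!
  obtain ⟨f, hf⟩ := exists_algHom_of_bijective hx hy hyx hb (F := F)
    ((Algebra.ofId L (AdjoinRoot (X ^ 3 - 1 : L[X]))).restrictScalars F)
    (v := AdjoinRoot.root (X ^ 3 - 1 : L[X])) hz
    (by
      have := AdjoinRoot.eval₂_root (X ^ 3 - 1 : L[X])
      simpa [sub_eq_zero] using this)
    (by rw [← map_pow, hzr, mul_comm])
  refine ⟨f, fun a ha j => ?_⟩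
  set p : L[X] := ∑ j : Fin 3, C (sliceEval x y m a j z) * X ^ (j : ℕ) with hp
  have hpd : p.degree < (X ^ 3 - 1 : L[X]).degree := by
    rw [hdeg]
    exact degree_sum_fin_lt _
  have hp0 : p = 0 := by
    refine eq_zero_of_dvd_of_degree_lt (AdjoinRoot.mk_eq_zero.1 ?_) hpd
    rw [← show f a = 0 from ha, hf, hp, map_sum]
    simp [Algebra.ofId_apply, AdjoinRoot.algebraMap_eq]
  have hj := congrArg (coeff · (j : ℕ)) hp0
  simpa [hp, finsetSum_coeff, coeff_C_mul, coeff_X_pow, Fin.val_inj] using hj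

/-- An automorphism `σ` of order three with `σ z = z ^ r` yields a homomorphism from the group algebra
to the endomorphism ring of `L` over the fixed field of `σ`, whose kernel consists of
elements with slices vanishing at `z`. -/
theorem exists_component_of_orderOf_eq_three [FiniteDimensional F L] [NeZero m]
    (hx : orderOf x = m) (hy : orderOf y = 3) (hyx : y * x = x ^ r * y)
    (hb : Function.Bijective fun p : Fin m × Fin 3 => x ^ (p.1 : ℕ) * y ^ (p.2 : ℕ))
    {z : L} (hz : z ^ m = 1) (σ : Gal(L/F)) (hσ : orderOf σ = 3) (hσz : σ z = z ^ r) :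
    ∃ f : MonoidAlgebra F G →+*
        Module.End (IntermediateField.fixedField (Subgroup.zpowers σ)) L,
      ∀ a, f a = 0 → ∀ j : Fin 3, sliceEval x y m a j z = 0 := by
  let K := IntermediateField.fixedField (Subgroup.zpowers σ)
  let v : Module.End K L :=
    { toFun := σ
      map_add' := map_add σ
      map_smul' := fun c l => by
        have hc : σ c = c := c.2 ⟨σ, Subgroup.mem_zpowers σ⟩
        change σ ((c : L) * l) = (c : L) * σ l
        rw [map_mul, hc] }
  have hvpow (n : ℕ) (l : L) : (v ^ n) l = (σ ^ n) l := by
    induction n generalizing l with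
    | zero => rfl
    | succ n ih => rw [pow_succ, pow_succ, Module.End.mul_apply, ih]; rfl
  obtain ⟨f, hf⟩ := exists_algHom_of_bijective hx hy hyx hb (F := F)
    ((Algebra.lmul K L).restrictScalars F) (v := v) hz
    (by
      ext l
      rw [hvpow, ← hσ, pow_orderOf_eq_one]
      rfl)
    (by
      rw [← map_pow]
      ext l
      change σ (z * l) = z ^ r * σ l
      rw [map_mul, hσz])
  refine ⟨f, fun a ha => ?_⟩
  have hinj : Function.Injective fun j : Fin 3 => ((σ ^ (j : ℕ) : Gal(L/F)) : L →* L) := by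
    intro i j hij
    have h : σ ^ (i : ℕ) = σ ^ (j : ℕ) := AlgEquiv.ext fun l => DFunLike.congr_fun hij l
    exact Fin.ext (pow_injOn_Iio_orderOf (by simp [hσ]) (by simp [hσ]) h)
  have hli := (linearIndependent_monoidHom L L).comp _ hinj
  refine Fintype.linearIndependent_iff.1 hli (fun j => sliceEval x y m a j z) ?_
  ext l
  have h := congrArg (fun g : Module.End K L => g l) ((hf a).symm.trans ha)
  simpa [LinearMap.sum_apply, hvpow] using h

theorem finrank_fixedField_zpowers [FiniteDimensional F L] (σ : Gal(L/F)) (hσ : orderOf σ = 3) :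
    Module.finrank (IntermediateField.fixedField (Subgroup.zpowers σ)) L = 3 := by
  rw [IntermediateField.finrank_fixedField_eq_card, Nat.card_zpowers, hσ]

end Components

section Cosets

/-- The `q`-cyclotomic coset of `s` modulo `m`. -/
def cyclotomicCoset (q m s : ℕ) : Set ℕ := {t | ∃ j : ℕ, t = s * q ^ j % m}

variable {q m : ℕ}

theorem cyclotomicCoset_subset_Iio (hm : 0 < m) (s : ℕ) : cyclotomicCoset q m s ⊆ Set.Iio m := by
  rintro _ ⟨j, rfl⟩
  exact Nat.mod_lt _ hm

theorem mem_cyclotomicCoset_self {s : ℕ} (hs : s < m) : s ∈ cyclotomicCoset q m s :=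
  ⟨0, by simp [Nat.mod_eq_of_lt hs]⟩

theorem cyclotomicCoset_eq_of_mem (hm : 0 < m) (hmq : Nat.Coprime m q) {s t : ℕ}
    (ht : t ∈ cyclotomicCoset q m s) : cyclotomicCoset q m t = cyclotomicCoset q m s := by
  obtain ⟨j, rfl⟩ := ht
  have hmul (i : ℕ) : s * q ^ j % m * q ^ i % m = s * q ^ (j + i) % m := by
    rw [Nat.mod_mul_mod, mul_assoc, pow_add]
  ext t
  constructor
  · rintro ⟨i, rfl⟩
    exact ⟨j + i, hmul i⟩
  · rintro ⟨i, rfl⟩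
    have hφ : 0 < m.totient := Nat.totient_pos.2 hm
    refine ⟨m.totient * j - j + i, ?_⟩
    rw [hmul]
    have hle : j ≤ m.totient * j := Nat.le_mul_of_pos_left _ hφ
    rw [show j + (m.totient * j - j + i) = m.totient * j + i by omega, pow_add, pow_mul]
    have h1 : (q ^ m.totient) ^ j ≡ 1 [MOD m] := by
      simpa using (Nat.ModEq.pow_totient hmq.symm).pow j
    have h2 : s * ((q ^ m.totient) ^ j * q ^ i) ≡ s * (1 * q ^ i) [MOD m] :=
      (h1.mul_right _).mul_left _
    rw [one_mul] at h2
    exact h2.symm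

theorem finite_setOf_cyclotomicCoset (q m : ℕ) :
    {J | ∃ s : ℕ, s < m ∧ J = cyclotomicCoset q m s}.Finite := by
  refine ((Set.finite_Iio m).image (cyclotomicCoset q m)).subset ?_
  rintro _ ⟨s, hs, rfl⟩
  exact ⟨s, hs, rfl⟩

theorem sum_ncard_cyclotomicCoset (hm : 0 < m) (hmq : Nat.Coprime m q)
    [Fintype {J // ∃ s : ℕ, s < m ∧ J = cyclotomicCoset q m s}] :
    ∑ J : {J // ∃ s : ℕ, s < m ∧ J = cyclotomicCoset q m s}, (J : Set ℕ).ncard = m := by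
  let c : Fin m → {J // ∃ s : ℕ, s < m ∧ J = cyclotomicCoset q m s} :=
    fun t => ⟨cyclotomicCoset q m t, t, t.2, rfl⟩
  have key : ∀ J, Nat.card {t // c t = J} = (J : Set ℕ).ncard := by
    rintro ⟨J, s, hs, rfl⟩
    rw [← Nat.card_coe_set_eq]
    have hiff (t : ℕ) (ht : t < m) : c ⟨t, ht⟩ = ⟨cyclotomicCoset q m s, s, hs, rfl⟩ ↔
        t ∈ cyclotomicCoset q m s := by
      rw [Subtype.mk.injEq]
      exact ⟨fun h => h ▸ mem_cyclotomicCoset_self ht, cyclotomicCoset_eq_of_mem hm hmq⟩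
    exact Nat.card_congr
      { toFun := fun t => ⟨t.1, (hiff t.1 t.1.2).1 t.2⟩
        invFun := fun t => ⟨⟨t.1, cyclotomicCoset_subset_Iio hm s t.2⟩, (hiff _ _).2 t.2⟩
        left_inv := fun t => rfl
        right_inv := fun t => rfl }
  rw [← Fintype.sum_congr _ _ key, ← Nat.card_sigma, Nat.card_congr (Equiv.sigmaFiberEquiv c),
    Nat.card_fin]

end Cosets

section FieldOfCoset

open IntermediateField FiniteField

variable {F E : Type*} [Field F] [Fintype F] [Field E] [Algebra F E] {ζ : E} {m : ℕ}

theorem IsPrimitiveRoot.pow_eq_pow_iff_mod_eq (hζ : IsPrimitiveRoot ζ m) (hm : 0 < m) {i j : ℕ} :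
    ζ ^ i = ζ ^ j ↔ i % m = j % m := by
  rw [(hζ.isOfFinOrder hm.ne').pow_inj_mod, ← hζ.eq_orderOf]

theorem frobenius_pow_apply {L : Type*} [Field L] [Algebra F L] [Algebra.IsAlgebraic F L]
    (n : ℕ) (l : L) :
    (frobeniusAlgEquivOfAlgebraic F L ^ n) l = l ^ Fintype.card F ^ n := by
  rw [AlgEquiv.coe_pow, coe_frobeniusAlgEquivOfAlgebraic_iterate]

omit [Fintype F] in
theorem algEquiv_eq_iff_apply_gen {w : E} (σ τ : Gal(F⟮w⟯/F)) :
    σ = τ ↔ σ (AdjoinSimple.gen F w) = τ (AdjoinSimple.gen F w) := by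
  refine ⟨fun h => h ▸ rfl, fun h => ?_⟩
  have := IntermediateField.algHom_ext_of_eq_adjoin F (S := F⟮w⟯) (s := {w}) rfl
    (φ₁ := (σ : F⟮w⟯ →ₐ[F] F⟮w⟯)) (φ₂ := (τ : F⟮w⟯ →ₐ[F] F⟮w⟯)) (by
      rintro _ rfl
      exact h)
  exact AlgEquiv.ext fun l => DFunLike.congr_fun this l

theorem ncard_cyclotomicCoset (hζ : IsPrimitiveRoot ζ m) (hm : 0 < m) (s : ℕ)
    [FiniteDimensional F F⟮ζ ^ s⟯] :
    (cyclotomicCoset (Fintype.card F) m s).ncard = Module.finrank F F⟮ζ ^ s⟯ := by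
  have : Finite F⟮ζ ^ s⟯ := Module.finite_of_finite F
  set q := Fintype.card F
  have key (i j : ℕ) : s * q ^ i % m = s * q ^ j % m ↔
      frobeniusAlgEquivOfAlgebraic F F⟮ζ ^ s⟯ ^ i = frobeniusAlgEquivOfAlgebraic F F⟮ζ ^ s⟯ ^ j := by
    rw [algEquiv_eq_iff_apply_gen, frobenius_pow_apply, frobenius_pow_apply, Subtype.ext_iff]
    simp only [SubmonoidClass.coe_pow, AdjoinSimple.coe_gen]
    rw [← pow_mul, ← pow_mul, hζ.pow_eq_pow_iff_mod_eq hm]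
  have hbij := bijective_frobeniusAlgEquivOfAlgebraic_pow F F⟮ζ ^ s⟯
  let g : Fin (Module.finrank F F⟮ζ ^ s⟯) → ℕ := fun n => s * q ^ (n : ℕ) % m
  have hg : Function.Injective g := fun i j hij => hbij.1 ((key i j).1 hij)
  have hr : Set.range g = cyclotomicCoset q m s := by
    ext t
    constructor
    · rintro ⟨n, rfl⟩
      exact ⟨n, rfl⟩
    · rintro ⟨j, rfl⟩
      obtain ⟨n, hn⟩ := hbij.2 (frobeniusAlgEquivOfAlgebraic F F⟮ζ ^ s⟯ ^ j)
      exact ⟨n, (key n j).2 hn⟩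
  rw [← hr, ← Nat.card_coe_set_eq, Nat.card_range_of_injective hg, Nat.card_fin]

end FieldOfCoset

section CosetComponent

open IntermediateField FiniteField

variable {F E : Type*} [Field F] [Fintype F] [Field E] [Algebra F E]
variable {G : Type*} [Group G] {x y : G} {m r : ℕ}

theorem sliceEval_pow_card_pow {L : Type*} [Field L] [Algebra F L] [Algebra.IsAlgebraic F L]
    (a : MonoidAlgebra F G) (j n : ℕ) (z : L) :
    sliceEval x y m a j (z ^ Fintype.card F ^ n) = sliceEval x y m a j z ^ Fintype.card F ^ n := by
  rw [← frobenius_pow_apply, ← frobenius_pow_apply]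
  simp only [sliceEval, map_sum, map_mul, AlgEquiv.commutes, map_pow]

omit [Fintype F] in
theorem algebraMap_sliceEval {L : Type*} [Field L] [Algebra F L] [Algebra L E]
    [IsScalarTower F L E] (a : MonoidAlgebra F G) (j : ℕ) (z : L) :
    algebraMap L E (sliceEval x y m a j z) = sliceEval x y m a j (algebraMap L E z) := by
  simp only [sliceEval, map_sum, map_mul, map_pow, ← IsScalarTower.algebraMap_apply]

theorem sliceEval_eq_zero_of_mem_cyclotomicCoset {ζ : E} (hζ : IsPrimitiveRoot ζ m)
    (hm : 0 < m) {s t : ℕ} [FiniteDimensional F F⟮ζ ^ s⟯]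
    (ht : t ∈ cyclotomicCoset (Fintype.card F) m s) {a : MonoidAlgebra F G} {j : ℕ}
    (h : sliceEval x y m a j (AdjoinSimple.gen F (ζ ^ s)) = 0) :
    sliceEval x y m a j (ζ ^ t) = 0 := by
  obtain ⟨n, rfl⟩ := ht
  have hpow : ζ ^ (s * Fintype.card F ^ n % m) =
      algebraMap F⟮ζ ^ s⟯ E (AdjoinSimple.gen F (ζ ^ s) ^ Fintype.card F ^ n) := by
    rw [map_pow, AdjoinSimple.algebraMap_gen, ← pow_mul, hζ.pow_eq_pow_iff_mod_eq hm,
      Nat.mod_mod]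
  rw [hpow, ← algebraMap_sliceEval, sliceEval_pow_card_pow, h,
    zero_pow (pow_pos Fintype.card_pos _).ne', map_zero]

/-- The number of left ideals in the component of the group algebra attached to the coset `J`. -/
noncomputable def componentCount (q m r : ℕ) (J : Set ℕ) : ℕ :=
  open Classical in
  if ∀ k ∈ J, r * k % m = k then if q ^ J.ncard % 3 = 1 then 8 else 4
  else 4 + 2 * q ^ (J.ncard / 3) + 2 * q ^ (2 * (J.ncard / 3))

theorem forall_mem_cyclotomicCoset_mul_mod {q s : ℕ} (hs : s < m) :
    (∀ k ∈ cyclotomicCoset q m s, r * k % m = k) ↔ r * s % m = s := by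
  refine ⟨fun h => h s (mem_cyclotomicCoset_self hs), ?_⟩
  rintro h _ ⟨j, rfl⟩
  rw [Nat.mul_mod_mod, ← mul_assoc, Nat.mul_mod, h, ← Nat.mod_eq_of_lt hs, ← Nat.mul_mod]
  simp

universe w in
theorem exists_component {E : Type w} [Field E] [Algebra F E] {ζ : E} (hζ : IsPrimitiveRoot ζ m)
    [NeZero m] (hx : orderOf x = m) (hy : orderOf y = 3) (hyx : y * x = x ^ r * y)
    (hb : Function.Bijective fun p : Fin m × Fin 3 => x ^ (p.1 : ℕ) * y ^ (p.2 : ℕ))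
    (hr3 : r ^ 3 ≡ 1 [MOD m]) {ε : ℕ} (hrq : r ≡ Fintype.card F ^ ε [MOD m])
    {s : ℕ} (hs : s < m) :
    ∃ (B : Type w) (_ : Ring B) (f : MonoidAlgebra F G →+* B),
      Nat.card B = Fintype.card F ^ (3 * (cyclotomicCoset (Fintype.card F) m s).ncard) ∧
      Nat.card (Ideal B) =
        componentCount (Fintype.card F) m r (cyclotomicCoset (Fintype.card F) m s) ∧
      ∀ a, f a = 0 → ∀ j : Fin 3, ∀ t ∈ cyclotomicCoset (Fintype.card F) m s,
        sliceEval x y m a j (ζ ^ t) = 0 := by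
  have hm : 0 < m := NeZero.pos m
  have hint : IsIntegral F (ζ ^ s) := IsIntegral.of_pow hm (by
    rw [← pow_mul, mul_comm, pow_mul, hζ.pow_eq_one, one_pow]
    exact isIntegral_one)
  have hfin : FiniteDimensional F F⟮ζ ^ s⟯ := adjoin.finiteDimensional hint
  have : Finite F⟮ζ ^ s⟯ := Module.finite_of_finite F
  have hd := ncard_cyclotomicCoset (F := F) hζ hm s
  have hL : Nat.card F⟮ζ ^ s⟯ =
      Fintype.card F ^ (cyclotomicCoset (Fintype.card F) m s).ncard := by
    rw [hd, Module.natCard_eq_pow_finrank (K := F), Nat.card_eq_fintype_card]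
  set z := AdjoinSimple.gen F (ζ ^ s) with hz
  have hzpow (i j : ℕ) : z ^ i = z ^ j ↔ s * i % m = s * j % m := by
    rw [Subtype.ext_iff]
    simp only [SubmonoidClass.coe_pow, hz, AdjoinSimple.coe_gen]
    rw [← pow_mul, ← pow_mul, hζ.pow_eq_pow_iff_mod_eq hm]
  have hzm : z ^ m = 1 := by
    rw [← pow_zero z, hzpow]
    simp
  have hiff := forall_mem_cyclotomicCoset_mul_mod (q := Fintype.card F) (r := r) hs
  have hzr : z ^ r = z ↔ r * s % m = s := by
    have := hzpow r 1
    rwa [pow_one, mul_one, Nat.mod_eq_of_lt hs, mul_comm] at this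
  by_cases hrs : r * s % m = s
  · obtain ⟨f, hf⟩ := exists_component_of_pow_eq_self (F := F) hx hy hyx hb hzm (hzr.2 hrs)
    refine ⟨_, inferInstance, f, ?_, ?_, fun a ha j t ht =>
      sliceEval_eq_zero_of_mem_cyclotomicCoset hζ hm ht (hf a ha j)⟩
    · rw [card_adjoinRoot_X_pow_three_sub_one, hL, ← pow_mul, mul_comm]
    · rw [card_ideal_adjoinRoot_X_pow_three_sub_one, hL, componentCount, if_pos (hiff.2 hrs)]
  · set σ := frobeniusAlgEquivOfAlgebraic F F⟮ζ ^ s⟯ ^ ε with hσdef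
    have hσz : σ z = z ^ r := by
      rw [hσdef, frobenius_pow_apply, hzpow]
      exact (hrq.mul_left s).symm
    have hσ : orderOf σ = 3 := by
      have : Fact (Nat.Prime 3) := ⟨Nat.prime_three⟩
      refine orderOf_eq_prime ?_ fun h => ?_
      · rw [algEquiv_eq_iff_apply_gen, ← hz]
        have h3 : (σ ^ 3) z = z ^ r ^ 3 := by
          rw [pow_succ, pow_two, AlgEquiv.mul_apply, AlgEquiv.mul_apply]
          simp only [hσz, map_pow]
          ring
        rw [h3, AlgEquiv.one_apply]
        nth_rewrite 2 [← pow_one z]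
        rw [hzpow]
        exact hr3.mul_left s
      · rw [h, AlgEquiv.one_apply] at hσz
        exact hrs (hzr.1 hσz.symm)
    obtain ⟨f, hf⟩ := exists_component_of_orderOf_eq_three (F := F) hx hy hyx hb hzm σ hσ hσz
    have h3 := finrank_fixedField_zpowers σ hσ
    have hdvd := Module.finrank_mul_finrank F (fixedField (Subgroup.zpowers σ)) F⟮ζ ^ s⟯
    rw [h3, ← hd] at hdvd
    have hK : Nat.card (fixedField (Subgroup.zpowers σ)) =
        Fintype.card F ^ ((cyclotomicCoset (Fintype.card F) m s).ncard / 3) := by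
      rw [Module.natCard_eq_pow_finrank (K := F), Nat.card_eq_fintype_card, ← hdvd,
        Nat.mul_div_cancel _ three_pos]
    refine ⟨_, inferInstance, f, ?_, ?_, fun a ha j t ht =>
      sliceEval_eq_zero_of_mem_cyclotomicCoset hζ hm ht (hf a ha j)⟩
    · rw [card_end_of_finrank_eq_three _ _ h3, hL, ← pow_mul, mul_comm]
    · rw [card_ideal_end_of_finrank_eq_three _ _ h3, hK, componentCount,
        if_neg (mt hiff.1 hrs), ← pow_mul, mul_comm 2 (_ / 3)]

omit [Fintype F] in
theorem eq_zero_of_sliceEval_eq_zero {ζ : E} (hζ : IsPrimitiveRoot ζ m)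
    (hb : Function.Bijective fun p : Fin m × Fin 3 => x ^ (p.1 : ℕ) * y ^ (p.2 : ℕ))
    {a : MonoidAlgebra F G}
    (ha : ∀ j : Fin 3, ∀ t < m, sliceEval x y m a j (ζ ^ t) = 0) : a = 0 := by
  have key (j : Fin 3) (i : Fin m) : a.coeff (x ^ (i : ℕ) * y ^ (j : ℕ)) = 0 := by
    let v : Fin m → E := fun i => algebraMap F E (a.coeff (x ^ (i : ℕ) * y ^ (j : ℕ)))
    have hinj : Function.Injective fun t : Fin m => ζ ^ (t : ℕ) := fun t t' h =>
      Fin.ext (hζ.pow_inj t.2 t'.2 h)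
    have hv : v = 0 := Matrix.eq_zero_of_forall_index_sum_mul_pow_eq_zero hinj fun t =>
      ha j t t.2
    simpa [v] using congrFun hv i
  ext g
  obtain ⟨⟨i, j⟩, rfl⟩ := hb.2 g
  exact key j i

end CosetComponent

theorem MonoidAlgebra.natCard_eq (F G : Type*) [Field F] [Fintype F] [Group G] [Fintype G] :
    Nat.card (MonoidAlgebra F G) = Fintype.card F ^ Fintype.card G := by
  rw [Nat.card_congr (MonoidAlgebra.coeffEquiv.trans Finsupp.equivFunOnFinite), Nat.card_fun,
    Nat.card_eq_fintype_card, Nat.card_eq_fintype_card]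

theorem card_ideal_eq_prod_componentCount {F G : Type*} [Field F] [Fintype F] [Group G]
    [Fintype G] {x y : G} {m r : ℕ} [NeZero m] (hmq : Nat.Coprime m (Fintype.card F))
    (hx : orderOf x = m) (hy : orderOf y = 3) (hyx : y * x = x ^ r * y)
    (hcard : Fintype.card G = 3 * m)
    (hgen : ∀ g : G, g ∈ Subgroup.closure ({x, y} : Set G))
    (hr3 : r ^ 3 ≡ 1 [MOD m]) {ε : ℕ} (hrq : r ≡ Fintype.card F ^ ε [MOD m])
    [Fintype {J // ∃ s : ℕ, s < m ∧ J = cyclotomicCoset (Fintype.card F) m s}] :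
    Nat.card (Ideal (MonoidAlgebra F G)) =
      ∏ J : {J // ∃ s : ℕ, s < m ∧ J = cyclotomicCoset (Fintype.card F) m s},
        componentCount (Fintype.card F) m r J := by
  have hm : 0 < m := NeZero.pos m
  have hb := bijective_pow_mul_pow hx hy hyx hcard hgen
  have : NeZero (m : F) := ⟨fun h => by
    have := Nat.Coprime.cast (R := F) hmq
    rw [h, FiniteField.cast_card_eq_zero] at this
    exact not_isCoprime_zero_zero this⟩
  have hζ := IsCyclotomicExtension.zeta_spec m F (CyclotomicField m F)
  have hex (J : {J // ∃ s : ℕ, s < m ∧ J = cyclotomicCoset (Fintype.card F) m s}) :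
      ∃ (B : Type _) (_ : Ring B) (f : MonoidAlgebra F G →+* B),
        Nat.card B = Fintype.card F ^ (3 * (J : Set ℕ).ncard) ∧
        Nat.card (Ideal B) = componentCount (Fintype.card F) m r J ∧
        ∀ a, f a = 0 → ∀ j : Fin 3, ∀ t ∈ (J : Set ℕ),
          sliceEval x y m a j (IsCyclotomicExtension.zeta m F (CyclotomicField m F) ^ t) = 0 := by
    obtain ⟨_, s, hs, rfl⟩ := J
    exact exists_component hζ hx hy hyx hb hr3 hrq hs
  choose B hB f hBcard hBideal hf using hex
  have hinj : Function.Injective (RingHom.pi f) := by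
    rw [injective_iff_map_eq_zero]
    intro a ha
    exact eq_zero_of_sliceEval_eq_zero hζ hb fun j t ht =>
      hf ⟨cyclotomicCoset _ m t, t, ht, rfl⟩ a (congrFun ha _) j t (mem_cyclotomicCoset_self ht)
  have hc : Nat.card (∀ J, B J) = Nat.card (MonoidAlgebra F G) := by
    rw [Nat.card_pi, MonoidAlgebra.natCard_eq, Finset.prod_congr rfl fun J _ => hBcard J,
      Finset.prod_pow_eq_pow_sum, ← Finset.mul_sum, sum_ncard_cyclotomicCoset hm hmq, hcard]
  have hfinite : Finite (∀ J, B J) := Nat.finite_of_card_ne_zero (by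
    rw [hc, MonoidAlgebra.natCard_eq]
    exact (pow_pos Fintype.card_pos _).ne')
  have hbij := hinj.bijective_of_nat_card_le hc.le
  rw [(RingEquiv.ofBijective _ hbij).card_ideal_eq, Nat.card_congr Ideal.piOrderIso.toEquiv,
    Nat.card_pi, Finset.prod_congr rfl fun J _ => hBideal J]

/-- Let `𝒥₁` be the set of `q`-cyclotomic cosets `J` modulo `m`
with `r·j ≡ j (mod m)` for all `j ∈ J`, and `𝒥₂` the set of remaining
`q`-cyclotomic cosets. Let `δ = |{J ∈ 𝒥₁ : q^{|J|} ≡ 1 (mod 3)}|`. Then the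
number of left ideals of `𝔽_q[G_{(m,3,r)}]` equals
`2^δ · 4^{|𝒥₁|} · ∏_{J ∈ 𝒥₂} (4 + 2q^{|J|/3} + 2q^{2|J|/3})`; in particular,
when `q ≡ 0 (mod 3)` one has `δ = 0` and the count is
`4^{|𝒥₁|} · ∏_{J ∈ 𝒥₂} (4 + 2q^{|J|/3} + 2q^{2|J|/3})`. -/
theorem stmt_15 (q m r : ℕ) (hq : IsPrimePow q) (hm : 3 ≤ m)
    (hmq : Nat.gcd m q = 1) (hr1 : 1 < r) (hrm : r < m)
    (hrgcd : Nat.gcd m r = 1) (hr3 : r ^ 3 ≡ 1 [MOD m])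
    (ε : ℕ) (hε : 0 < ε) (hrq : r ≡ q ^ ε [MOD m])
    (F : Type*) [Field F] [Fintype F] (hF : Fintype.card F = q)
    (G : Type*) [Group G] [Fintype G] (x y : G)
    (hx : orderOf x = m) (hy : orderOf y = 3)
    (hyx : y * x = x ^ r * y)
    (hcard : Fintype.card G = 3 * m)
    (hgen : ∀ g : G, g ∈ Subgroup.closure ({x, y} : Set G))
    (Cosets J1 J2 : Set (Set ℕ))
    (hCosets : Cosets = {J | ∃ s : ℕ, s < m ∧ J = {t | ∃ j : ℕ, t = s * q ^ j % m}})
    (hJ1 : J1 = {J ∈ Cosets | ∀ k ∈ J, r * k % m = k})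
    (hJ2 : J2 = Cosets \ J1)
    (δ : ℕ) (hδ : δ = ({J ∈ J1 | q ^ J.ncard % 3 = 1}).ncard) :
    Nat.card (Ideal (MonoidAlgebra F G)) =
      2 ^ δ * 4 ^ J1.ncard *
        ∏ᶠ J ∈ J2, (4 + 2 * q ^ (J.ncard / 3) + 2 * q ^ (2 * (J.ncard / 3))) ∧
    (q % 3 = 0 → δ = 0 ∧
      Nat.card (Ideal (MonoidAlgebra F G)) =
        4 ^ J1.ncard *
          ∏ᶠ J ∈ J2, (4 + 2 * q ^ (J.ncard / 3) + 2 * q ^ (2 * (J.ncard / 3)))) := by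
  classical
  have : NeZero m := ⟨by omega⟩
  have hCfin : Cosets.Finite := hCosets ▸ finite_setOf_cyclotomicCoset q m
  have hJ1C : J1 ⊆ Cosets := hJ1 ▸ Set.sep_subset _ _
  have hJ1fin : J1.Finite := hCfin.subset hJ1C
  have hδfin : {J ∈ J1 | q ^ J.ncard % 3 = 1}.Finite := hJ1fin.subset (Set.sep_subset _ _)
  have hmem1 {J : Set ℕ} (hJ : J ∈ J1) : ∀ k ∈ J, r * k % m = k := (hJ1 ▸ hJ).2
  have hmem2 {J : Set ℕ} (hJ : J ∈ J2) : ¬ ∀ k ∈ J, r * k % m = k := fun h => by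
    rw [hJ2] at hJ
    exact hJ.2 (hJ1 ▸ ⟨hJ.1, h⟩)
  have hcount : Nat.card (Ideal (MonoidAlgebra F G)) = ∏ᶠ J ∈ Cosets, componentCount q m r J := by
    subst hF
    have : Fintype {J // ∃ s : ℕ, s < m ∧ J = cyclotomicCoset (Fintype.card F) m s} :=
      (finite_setOf_cyclotomicCoset (Fintype.card F) m).fintype
    rw [card_ideal_eq_prod_componentCount hmq hx hy hyx hcard hgen hr3 hrq,
      ← finprod_eq_prod_of_fintype, hCosets]
    exact finprod_set_coe_eq_finprod_mem _
  have hprod1 : ∏ᶠ J ∈ J1, componentCount q m r J = 2 ^ δ * 4 ^ J1.ncard := by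
    have h : ∀ J ∈ J1, componentCount q m r J = (if q ^ J.ncard % 3 = 1 then 2 else 1) * 4 := by
      intro J hJ
      rw [componentCount, if_pos (hmem1 hJ)]
      split_ifs <;> rfl
    rw [finprod_mem_congr rfl h, finprod_mem_eq_finite_toFinset_prod _ hJ1fin,
      Finset.prod_mul_distrib, Finset.prod_const, ← Finset.prod_filter, Finset.prod_const,
      Set.ncard_eq_toFinset_card _ hJ1fin, hδ, Set.ncard_eq_toFinset_card _ hδfin]
    congr 3
    ext J
    simp
  have hprod2 : ∏ᶠ J ∈ J2, componentCount q m r J =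
      ∏ᶠ J ∈ J2, (4 + 2 * q ^ (J.ncard / 3) + 2 * q ^ (2 * (J.ncard / 3))) :=
    finprod_mem_congr rfl fun J hJ => if_neg (hmem2 hJ)
  have hmain : Nat.card (Ideal (MonoidAlgebra F G)) = 2 ^ δ * 4 ^ J1.ncard *
      ∏ᶠ J ∈ J2, (4 + 2 * q ^ (J.ncard / 3) + 2 * q ^ (2 * (J.ncard / 3))) := by
    rw [hcount, ← hprod1, ← hprod2, hJ2, finprod_mem_mul_sdiff hJ1C hCfin]
  refine ⟨hmain, fun hq3 => ?_⟩
  have hδ0 : δ = 0 := by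
    rw [hδ, Set.ncard_eq_zero hδfin, Set.eq_empty_iff_forall_notMem]
    rintro J ⟨hJ, h⟩
    have hJC := hJ1C hJ
    rw [hCosets] at hJC
    obtain ⟨s, hs, rfl⟩ := hJC
    have hpos : 0 < (cyclotomicCoset q m s).ncard :=
      (Set.ncard_pos ((Set.finite_Iio m).subset (cyclotomicCoset_subset_Iio (by omega) s))).2
        ⟨s, mem_cyclotomicCoset_self hs⟩
    have h0 : q ^ (cyclotomicCoset q m s).ncard % 3 = 0 := by
      rw [Nat.pow_mod, hq3, zero_pow hpos.ne', Nat.zero_mod]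
    exact absurd (h0.symm.trans h) (by norm_num)
  refine ⟨hδ0, ?_⟩
  rw [hmain, hδ0, pow_zero, one_mul]
end
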